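/- arXiv:1503.03604 — 3 statements merged into one kernel-verified Lean document; each statement's English description precedes it below -/
import Mathlib

section
/- Let p₁ and p₂ be distinct primes with p₁ ≡ p₂ ≡ 5 (mod 8). Then the 2-Sylow subgroup of the ideal class group of ℚ(√(2p₁p₂)) and the 2-Sylow subgroup of the ideal class group of ℚ(√(−2p₁p₂)) are both isomorphic to ℤ/2ℤ × ℤ/2ℤ. -/
open NumberField IntermediateField

/-- A quadratic form `q n² ∓ (a² - p m b²)` is anisotropic when `q` is a non-residue modulo the
prime `p ≡ 1 (mod 4)` and `p ∤ m`. -/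
theorem eq_zero_of_mul_sq_eq {p : ℕ} (hp : p.Prime) (hp4 : p % 4 = 1) {q m f : ℤ}
    (hf : f = 1 ∨ f = -1) (hq : ¬ IsSquare (q : ZMod p)) (hm : ¬ (p : ℤ) ∣ m) (n : ℤ) :
    ∀ a b : ℤ, q * n ^ 2 = f * (a ^ 2 - p * m * b ^ 2) → n = 0 := by
  have := Fact.mk hp
  have hpz : Prime (p : ℤ) := Nat.prime_iff_prime_int.mp hp
  have hfsq : IsSquare (f : ZMod p) := by
    rcases hf with rfl | rfl
    · simp
    · simpa using ZMod.exists_sq_eq_neg_one_iff.mpr (by omega : p % 4 ≠ 3)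
  obtain ⟨c, hc⟩ := hfsq
  induction hk : n.natAbs using Nat.strong_induction_on generalizing n with
  | _ k ih =>
    intro a b h
    by_contra hn
    have hmod : (q : ZMod p) * n ^ 2 = f * a ^ 2 := by
      have := congrArg (Int.cast : ℤ → ZMod p) h
      push_cast at this
      simpa using this
    have hpn : (p : ℤ) ∣ n := by
      by_contra hpn
      have hn0 : (n : ZMod p) ≠ 0 := by rwa [Ne, ZMod.intCast_zmod_eq_zero_iff_dvd]
      refine hq ⟨c * a / n, ?_⟩
      field_simp
      rw [hmod, hc]
      ring
    have hpa : (p : ℤ) ∣ a := by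
      have h1 : (p : ℤ) ∣ a ^ 2 := by
        have h2 : a ^ 2 = f * (q * n * n) + p * (m * b ^ 2) := by
          rcases hf with rfl | rfl <;> linarith
        rw [h2]
        exact dvd_add (Dvd.dvd.mul_left (Dvd.dvd.mul_left hpn _) _) (dvd_mul_right _ _)
      exact hpz.dvd_of_dvd_pow h1
    obtain ⟨n', rfl⟩ := hpn
    obtain ⟨a', rfl⟩ := hpa
    have h3 : (p : ℤ) * (q * n' ^ 2) = f * (p * a' ^ 2 - m * b ^ 2) := by
      apply mul_left_cancel₀ hpz.ne_zero
      linear_combination h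
    have hpb : (p : ℤ) ∣ b := by
      have h1 : (p : ℤ) ∣ m * b ^ 2 :=
        ⟨a' ^ 2 - f * (q * n' ^ 2), by
          rcases hf with rfl | rfl
          · linear_combination h3
          · linear_combination -h3⟩
      exact hpz.dvd_of_dvd_pow ((hpz.dvd_or_dvd h1).resolve_left hm)
    obtain ⟨b', rfl⟩ := hpb
    have hn' : n' ≠ 0 := by rintro rfl; simp at hn
    refine hn' (ih n'.natAbs ?_ n' rfl a' b' ?_)
    · rw [← hk, Int.natAbs_mul, Int.natAbs_natCast]
      exact (Nat.lt_mul_iff_one_lt_left (Int.natAbs_pos.mpr hn')).mpr hp.one_lt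
    · apply mul_left_cancel₀ hpz.ne_zero
      linear_combination h3

theorem exists_mul_sq_of_coprime {a b c v : ℕ} (hab : a.Coprime b) (hc : 0 < c)
    (h : a * b = c * v ^ 2) :
    ∃ c₁ c₂ r s : ℕ, a = c₁ * r ^ 2 ∧ b = c₂ * s ^ 2 ∧ c₁ * c₂ = c := by
  have hcc : c.gcd a * c.gcd b = c := by
    rw [← hab.gcd_mul, h, Nat.gcd_eq_left (dvd_mul_right _ _)]
  obtain ⟨a', ha⟩ := Nat.gcd_dvd_right c a
  obtain ⟨b', hb⟩ := Nat.gcd_dvd_right c b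
  have hv : a' * b' = v ^ 2 := by
    apply Nat.eq_of_mul_eq_mul_left hc
    calc c * (a' * b') = c.gcd a * a' * (c.gcd b * b') := by nth_rw 1 [← hcc]; ring
      _ = c * v ^ 2 := by rw [← ha, ← hb, h]
  have hab' : a'.Coprime b' :=
    hab.of_dvd (Dvd.intro_left _ ha.symm) (Dvd.intro_left _ hb.symm)
  obtain ⟨r, hr⟩ := exists_eq_pow_of_mul_eq_pow (Nat.isUnit_iff.mpr hab') hv
  obtain ⟨s, hs⟩ := exists_eq_pow_of_mul_eq_pow
    (Nat.isUnit_iff.mpr hab'.symm) ((mul_comm _ _).trans hv)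
  exact ⟨_, _, r, s, hr ▸ ha, hs ▸ hb, hcc⟩

/-- The integers `d = ±2p₁p₂`, with `p₁ ≠ p₂` primes congruent to `5` modulo `8`. -/
structure IsRadicand (p₁ p₂ : ℕ) (d : ℤ) : Prop where
  prime₁ : p₁.Prime
  prime₂ : p₂.Prime
  ne : p₁ ≠ p₂
  mod₁ : p₁ % 8 = 5
  mod₂ : p₂ % 8 = 5
  eq : d = 2 * p₁ * p₂ ∨ d = -(2 * p₁ * p₂)

namespace IsRadicand

variable {p₁ p₂ : ℕ} {d : ℤ}

theorem symm (h : IsRadicand p₁ p₂ d) : IsRadicand p₂ p₁ d :=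
  ⟨h.prime₂, h.prime₁, h.ne.symm, h.mod₂, h.mod₁, by
    rw [mul_right_comm]
    exact h.eq⟩

theorem exists_sign (h : IsRadicand p₁ p₂ d) :
    ∃ e : ℤ, (e = 1 ∨ e = -1) ∧ d = e * (2 * p₁ * p₂) := by
  rcases h.eq with h | h
  · exact ⟨1, .inl rfl, by linarith⟩
  · exact ⟨-1, .inr rfl, by linarith⟩

theorem not_dvd (h : IsRadicand p₁ p₂ d) {e : ℤ} (he : e = 1 ∨ e = -1) :
    ¬ (p₁ : ℤ) ∣ e * (2 * p₂) := by
  have h2 : ¬ p₁ ∣ 2 * p₂ := by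
    rw [h.prime₁.dvd_mul, Nat.prime_dvd_prime_iff_eq h.prime₁ Nat.prime_two,
      Nat.prime_dvd_prime_iff_eq h.prime₁ h.prime₂]
    have := h.mod₁
    have := h.ne
    omega
  have h3 : ¬ (p₁ : ℤ) ∣ 2 * p₂ := by exact_mod_cast h2
  rcases he with rfl | rfl <;> simpa using h3

theorem not_isSquare_two (h : IsRadicand p₁ p₂ d) : ¬ IsSquare (2 : ZMod p₁) := by
  have := Fact.mk h.prime₁
  have := h.mod₁
  rw [ZMod.exists_sq_eq_two_iff (by rintro rfl; omega)]
  omega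

theorem eq_zero_of_two_mul_sq_eq (h : IsRadicand p₁ p₂ d) {f n a b : ℤ} (hf : f = 1 ∨ f = -1)
    (hn : 2 * n ^ 2 = f * (a ^ 2 - d * b ^ 2)) : n = 0 := by
  obtain ⟨e, he, rfl⟩ := h.exists_sign
  have := h.mod₁
  refine eq_zero_of_mul_sq_eq h.prime₁ (by omega) hf (q := 2)
    (by exact_mod_cast h.not_isSquare_two) (h.not_dvd he) n a b ?_
  linear_combination hn

theorem eq_zero_of_prime_mul_sq_eq (h : IsRadicand p₁ p₂ d) {f n a b : ℤ} (hf : f = 1 ∨ f = -1)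
    (hn : p₁ * n ^ 2 = f * (a ^ 2 - d * b ^ 2)) : n = 0 := by
  obtain ⟨e, he, rfl⟩ := h.exists_sign
  have := Fact.mk h.prime₁
  have := Fact.mk h.prime₂
  have h₁ := h.mod₁
  have h₂ := h.mod₂
  by_cases hsq : IsSquare (p₁ : ZMod p₂)
  · have hsq' : IsSquare (p₂ : ZMod p₁) :=
      (ZMod.exists_sq_eq_prime_iff_of_mod_four_eq_one (by omega) (by rintro rfl; omega)).mpr hsq
    have hes : IsSquare (e : ZMod p₁) := by
      rcases he with rfl | rfl
      · simp
      · simpa using ZMod.exists_sq_eq_neg_one_iff.mpr (by omega : p₁ % 4 ≠ 3)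
    have hns : ¬ IsSquare (((e * (2 * p₂) : ℤ)) : ZMod p₁) := by
      intro hs
      have hp0 : (p₂ : ZMod p₁) ≠ 0 := ZMod.prime_ne_zero p₁ p₂ h.ne
      have he0 : (e : ZMod p₁) ≠ 0 := by rcases he with rfl | rfl <;> simp
      have h2 := (hs.div hsq').div hes
      push_cast at h2
      have h3 : (e * (2 * p₂) / p₂ / e : ZMod p₁) = 2 := by field_simp
      exact h.not_isSquare_two (h3 ▸ h2)
    obtain ⟨a', rfl⟩ : (p₁ : ℤ) ∣ a := by
      refine (Nat.prime_iff_prime_int.mp h.prime₁).dvd_of_dvd_pow (n := 2)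
        ⟨f * n ^ 2 + e * (2 * p₂) * b ^ 2, ?_⟩
      rcases hf with rfl | rfl
      · linear_combination -hn
      · linear_combination hn
    have hp0 : (p₁ : ℤ) ≠ 0 := by exact_mod_cast h.prime₁.ne_zero
    have key : n ^ 2 = f * (p₁ * a' ^ 2 - e * (2 * p₂) * b ^ 2) := by
      apply mul_left_cancel₀ hp0
      linear_combination hn
    refine eq_zero_of_mul_sq_eq h.prime₁ (by omega) (f := -f) (by omega) hns (h.not_dvd he) n
      (e * (2 * p₂) * b) a' ?_
    linear_combination (e * (2 * p₂)) * key
  · have h' := h.symm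
    refine eq_zero_of_mul_sq_eq h.prime₂ (by omega) hf (q := p₁)
      (by exact_mod_cast hsq) (h.symm.not_dvd he) n a b ?_
    linear_combination hn

theorem exists_pell_neg_one (h : IsRadicand p₁ p₂ d) (hd : 0 < d) :
    ∃ t u : ℤ, t ^ 2 - d * u ^ 2 = -1 := by
  have hp₁ := h.prime₁.pos
  have hp₂ := h.prime₂.pos
  have hpp : (0 : ℤ) < 2 * p₁ * p₂ := by positivity
  have hde : d = 2 * p₁ * p₂ := by rcases h.eq with h | h <;> linarith
  have hnsq : ¬ IsSquare d := by
    rintro ⟨r, hr⟩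
    have := h.eq_zero_of_two_mul_sq_eq (f := -1) (n := 2 * r) (a := r) (b := 3) (.inr rfl)
      (by rw [hr]; ring)
    have hr0 : r = 0 := by omega
    simp [hr, hr0] at hd
  obtain ⟨s, hs⟩ := Pell.IsFundamental.exists_of_not_isSquare hd hnsq
  have hx1 : 1 < s.x := hs.1
  have hy0 : 0 < s.y := hs.2.1
  have hpell := s.prop
  obtain ⟨m, hm⟩ : ∃ m : ℤ, d = 2 * (2 * m + 1) := by
    refine ⟨(p₁ * p₂ : ℤ) / 2, ?_⟩
    have : (p₁ * p₂ : ℤ) % 2 = 1 := by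
      have h₁ : (p₁ : ℤ) % 2 = 1 := by have := h.mod₁; omega
      have h₂ : (p₂ : ℤ) % 2 = 1 := by have := h.mod₂; omega
      rw [Int.mul_emod, h₁, h₂]; rfl
    rw [hde]
    have := Int.emod_add_mul_ediv (p₁ * p₂ : ℤ) 2
    linarith
  have hxodd : s.x % 2 = 1 := by
    rcases Int.emod_two_eq_zero_or_one s.x with hx | hx
    · obtain ⟨l, hl⟩ := Int.dvd_of_emod_eq_zero hx
      have h1 : 2 * (2 * l ^ 2 - (2 * m + 1) * s.y ^ 2) = 1 := by
        rw [hl] at hpell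
        linear_combination hpell + s.y ^ 2 * hm
      omega
    · exact hx
  obtain ⟨k, hk⟩ : ∃ k : ℕ, s.x = 2 * k + 1 := ⟨((s.x - 1) / 2).toNat, by omega⟩
  have hyeven : s.y % 2 = 0 := by
    rcases Int.emod_two_eq_zero_or_one s.y with hy | hy
    · exact hy
    · exfalso
      obtain ⟨l, hl⟩ : ∃ l : ℤ, s.y = 2 * l + 1 := ⟨s.y / 2, by omega⟩
      rw [hk, hl, hm] at hpell
      have h2 : 2 * ((k : ℤ) ^ 2 + k) = (2 * m + 1) * (2 * (2 * (l ^ 2 + l)) + 1) := by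
        linarith
      have h3 := congrArg (· % 2) h2
      simp [Int.mul_emod, Int.add_emod] at h3
  obtain ⟨v, hv⟩ : ∃ v : ℕ, s.y = 2 * v := ⟨(s.y / 2).toNat, by omega⟩
  have hmain : k * (k + 1) = (2 * p₁ * p₂) * v ^ 2 := by
    zify
    rw [hk, hv, hde] at hpell
    linarith
  obtain ⟨d₁, d₂, r, q, hr, hq, hdd⟩ := exists_mul_sq_of_coprime (by simp) (by positivity) hmain
  have hdiff : (d₂ : ℤ) * q ^ 2 - d₁ * r ^ 2 = 1 := by
    have h1 : d₂ * q ^ 2 = d₁ * r ^ 2 + 1 := by omega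
    have h2 : (d₂ : ℤ) * q ^ 2 = d₁ * r ^ 2 + 1 := by exact_mod_cast h1
    linarith
  have hddz : d = (d₁ : ℤ) * d₂ := by
    rw [hde]
    exact_mod_cast hdd.symm
  have key₁ : (d₁ : ℤ) * 1 ^ 2 = -1 * ((d₁ * r) ^ 2 - d * q ^ 2) := by
    rw [hddz]
    linear_combination (-d₁ : ℤ) * hdiff
  have key₂ : (d₂ : ℤ) * 1 ^ 2 = 1 * ((d₂ * q) ^ 2 - d * r ^ 2) := by
    rw [hddz]
    linear_combination (-d₂ : ℤ) * hdiff
  have hne2 : ∀ {c : ℕ} {f a b : ℤ}, (f = 1 ∨ f = -1) →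
      (c : ℤ) * 1 ^ 2 = f * (a ^ 2 - d * b ^ 2) → c ≠ 2 ∧ c ≠ p₁ ∧ c ≠ p₂ := by
    intro c f a b hf hc
    refine ⟨?_, ?_, ?_⟩ <;> rintro rfl
    · simpa using h.eq_zero_of_two_mul_sq_eq (n := 1) hf (by simpa using hc)
    · simpa using h.eq_zero_of_prime_mul_sq_eq hf hc
    · simpa using h.symm.eq_zero_of_prime_mul_sq_eq hf hc
  obtain ⟨h12, h1p, h1p'⟩ := hne2 (.inr rfl) key₁
  obtain ⟨h22, h2p, h2p'⟩ := hne2 (.inl rfl) key₂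
  obtain ⟨c, c₂, hc, hc₂, rfl⟩ := Nat.dvd_mul.mp (Dvd.intro _ hdd)
  obtain ⟨c₀, c₁, hc₀, hc₁, rfl⟩ := Nat.dvd_mul.mp hc
  have e₀ := (Nat.dvd_prime Nat.prime_two).mp hc₀
  have e₁ := (Nat.dvd_prime h.prime₁).mp hc₁
  have e₂ := (Nat.dvd_prime h.prime₂).mp hc₂
  have hcases : (c₀ * c₁ * c₂ = 1) ∨ d₂ = 1 := by
    have hpos₁ := h.prime₁.ne_zero
    have hpos₂ := h.prime₂.ne_zero
    rcases e₀ with rfl | rfl <;> rcases e₁ with rfl | rfl <;> rcases e₂ with rfl | rfl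
    · simp
    · simp at h1p'
    · simp at h1p
    · refine absurd ?_ h22
      apply Nat.eq_of_mul_eq_mul_left (Nat.mul_pos hp₁ hp₂)
      linarith
    · simp at h12
    · refine absurd ?_ h2p
      apply Nat.eq_of_mul_eq_mul_left (Nat.mul_pos Nat.two_pos hp₂)
      linarith
    · refine absurd ?_ h2p'
      apply Nat.eq_of_mul_eq_mul_left (Nat.mul_pos Nat.two_pos hp₁)
      linarith
    · right
      apply Nat.eq_of_mul_eq_mul_left (Nat.mul_pos (Nat.mul_pos Nat.two_pos hp₁) hp₂)
      linarith
  rcases hcases with h1 | h1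
  · refine ⟨r, q, ?_⟩
    rw [h1] at hddz hdiff
    rw [hddz]
    push_cast at hdiff ⊢
    linarith
  · exfalso
    rw [h1] at hddz hdiff hq
    have hsol : (q : ℤ) ^ 2 - d * (r : ℤ) ^ 2 = 1 := by
      rw [hddz]
      push_cast at hdiff ⊢
      linarith
    have hq1 : 1 < q := by
      by_contra! hq1
      have : q ^ 2 ≤ 1 := pow_le_one₀ (Nat.zero_le q) hq1
      omega
    have hle := hs.x_le_x (a := Pell.Solution₁.mk q r hsol) (by simpa using hq1)
    rw [Pell.Solution₁.x_mk, hk] at hle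
    have : k + 1 = q * q := by linarith
    nlinarith

end IsRadicand

theorem sylow_two_equiv_of_mulEquiv {G G' : Type*} [CommGroup G] [CommGroup G'] (e : G ≃* G')
    {a b : G'} (ha : a ^ 2 = 1) (hb : b ^ 2 = 1) (ha' : ¬ IsSquare a) (hb' : ¬ IsSquare b)
    (hab' : ¬ IsSquare (a * b)) (htors : ∀ g : G', g ^ 2 = 1 → g ∈ Subgroup.closure {a, b})
    (P : Sylow 2 G) : Nonempty (Additive P ≃+ (ZMod 2 × ZMod 2)) := by
  have hpow : ∀ {c : G'}, c ^ 2 = 1 → ∀ n : ℤ, c ^ n = 1 ∨ c ^ n = c := by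
    intro c hc n
    have hc' : c ^ (2 : ℤ) = 1 := by exact_mod_cast hc
    rcases Int.even_or_odd' n with ⟨k, rfl | rfl⟩
    · left; rw [zpow_mul, hc', one_zpow]
    · right; rw [zpow_add, zpow_mul, hc', one_zpow, one_mul, zpow_one]
  have htors' : ∀ g : G', g ^ 2 = 1 → g = 1 ∨ g = a ∨ g = b ∨ g = a * b := by
    intro g hg
    obtain ⟨m, n, rfl⟩ := Subgroup.mem_closure_pair.mp (htors g hg)
    rcases hpow ha m with h1 | h1 <;> rcases hpow hb n with h2 | h2 <;> simp [h1, h2]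
  have h4 : ∀ g : G', g ^ 4 = 1 → g ^ 2 = 1 := by
    intro g hg
    have hsq : IsSquare (g ^ 2) := ⟨g, pow_two g⟩
    rcases htors' (g ^ 2) (by rw [← pow_mul, hg]) with h | h | h | h
    · exact h
    all_goals rw [h] at hsq; contradiction
  have h2 : ∀ (k : ℕ) (g : G'), g ^ 2 ^ k = 1 → g ^ 2 = 1 := by
    intro k
    induction k with
    | zero => intro g hg; simp_all
    | succ k ih =>
      intro g hg
      refine h4 g ?_
      have := ih (g ^ 2) (by rw [← pow_mul, ← pow_succ', hg])
      rw [← this, ← pow_mul]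
  have hP : ∀ g : G, g ∈ (P : Subgroup G) ↔ g ^ 2 = 1 := by
    intro g
    constructor
    · intro hg
      obtain ⟨k, hk⟩ := P.isPGroup' ⟨g, hg⟩
      have hk' : g ^ 2 ^ k = 1 := by simpa using congrArg Subtype.val hk
      apply e.injective
      rw [map_pow, map_one]
      exact h2 k _ (by rw [← map_pow, hk', map_one])
    · intro hg
      have hz : IsPGroup 2 (Subgroup.zpowers g) := by
        rintro ⟨_, n, rfl⟩
        refine ⟨1, Subtype.ext ?_⟩
        have hg' : g ^ (2 : ℤ) = 1 := by exact_mod_cast hg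
        change (g ^ n) ^ 2 ^ 1 = 1
        rw [pow_one, ← zpow_natCast, ← zpow_mul, mul_comm, zpow_mul]
        simp [hg]
      have hs := P.is_maximal' (hz.to_sup_of_normal_right P.isPGroup') le_sup_right
      rw [← hs]
      exact (le_sup_left : Subgroup.zpowers g ≤ _) (Subgroup.mem_zpowers g)
  have hset : ((P : Subgroup G) : Set G) =
      e.symm '' {1, a, b, a * b} := by
    ext g
    rw [SetLike.mem_coe, hP]
    constructor
    · intro hg
      exact ⟨e g, by simpa using htors' (e g) (by rw [← map_pow, hg, map_one]), by simp⟩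
    · rintro ⟨c, hc, rfl⟩
      rw [← map_pow]
      rcases hc with rfl | rfl | rfl | rfl <;> simp [ha, hb, mul_pow]
  have hone : ∀ {c : G'}, ¬ IsSquare c → c ≠ 1 := by
    rintro c hc rfl
    exact hc IsSquare.one
  have hane := hone ha'
  have hbne := hone hb'
  have hcard : Nat.card (P : Subgroup G) = 4 := by
    have hne : a ≠ b := by
      rintro rfl
      exact hone hab' (by rw [← pow_two, ha])
    change Nat.card ((P : Subgroup G) : Set G) = 4
    rw [Nat.card_coe_set_eq, hset, Set.ncard_image_of_injective _ e.symm.injective]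
    rw [Set.ncard_insert_of_notMem, Set.ncard_insert_of_notMem, Set.ncard_pair]
    · simpa using hane
    · simp [hne, hbne]
    · simp [hane.symm, hbne.symm, (hone hab').symm]
  have hexp : Monoid.exponent P = 2 := by
    refine Nat.prime_two.eq_one_or_self_of_dvd _ ?_ |>.resolve_left ?_
    · exact Monoid.exponent_dvd_of_forall_pow_eq_one fun g => Subtype.ext ((hP g).mp g.2)
    · rw [Monoid.exp_eq_one_iff]
      intro hsub
      rw [Nat.card_of_subsingleton (1 : (P : Subgroup G))] at hcard
      omega
  have : IsKleinFour P := ⟨hcard, hexp⟩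
  obtain ⟨f⟩ := IsKleinFour.nonempty_mulEquiv (G₁ := P) (G₂ := Multiplicative (ZMod 2 × ZMod 2))
  exact ⟨MulEquiv.toAdditiveLeft f⟩

theorem exists_intCast_eq_of_squarefree_mul_sq {d : ℤ} (hd : Squarefree d) {q : ℚ} {m : ℤ}
    (h : d * q ^ 2 = m) : ∃ n : ℤ, q = n := by
  have hq : (q.den : ℚ) ≠ 0 := by exact_mod_cast q.den_ne_zero
  have h1 : d * q.num ^ 2 = m * (q.den : ℤ) ^ 2 := by
    have h2 : (d : ℚ) * q.num ^ 2 = m * (q.den : ℚ) ^ 2 := by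
      rw [← h]
      nth_rw 2 [← Rat.num_div_den q]
      field_simp
    exact_mod_cast h2
  have hcop : IsCoprime ((q.den : ℤ) ^ 2) (q.num ^ 2) := by
    refine IsCoprime.pow ?_
    rw [Int.isCoprime_iff_gcd_eq_one, Int.gcd_comm]
    exact q.reduced
  have hdvd : (q.den : ℤ) * q.den ∣ d := by
    rw [← pow_two]
    exact hcop.dvd_of_dvd_mul_right (Dvd.intro_left _ h1.symm)
  have hden : q.den = 1 := by
    simpa [Int.isUnit_iff_natAbs_eq] using hd _ hdvd
  exact ⟨q.num, ((Rat.den_eq_one_iff q).mp hden).symm⟩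

theorem exists_intCast_eq_of_trace_norm {d : ℤ} (hd : Squarefree d) (hd4 : d % 4 = 2) {a b : ℚ}
    {t n : ℤ} (ht : 2 * a = t) (hn : a * a - d * (b * b) = n) :
    ∃ a' b' : ℤ, a = a' ∧ b = b' := by
  obtain ⟨c, hc⟩ := exists_intCast_eq_of_squarefree_mul_sq hd (q := 2 * b) (m := t ^ 2 - 4 * n)
    (by push_cast; rw [← ht, ← hn]; ring)
  have h1 : t ^ 2 - d * c ^ 2 = 4 * n := by
    have : (t : ℚ) ^ 2 - d * c ^ 2 = 4 * n := by rw [← ht, ← hn, ← hc]; ring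
    exact_mod_cast this
  obtain ⟨e, rfl⟩ : ∃ e, d = 4 * e + 2 := ⟨d / 4, by omega⟩
  obtain ⟨t', rfl⟩ : (2 : ℤ) ∣ t := by
    refine Int.prime_two.dvd_of_dvd_pow (n := 2) ⟨2 * n + (2 * e + 1) * c ^ 2, ?_⟩
    linarith
  obtain ⟨c', rfl⟩ : (2 : ℤ) ∣ c := by
    refine Int.prime_two.dvd_of_dvd_pow (n := 2) ⟨t' ^ 2 - n - e * c ^ 2, ?_⟩
    linarith
  push_cast at ht hc
  exact ⟨t', c', by linarith, by linarith⟩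

theorem QuadraticAlgebra.exists_intCast_eq_of_isIntegral {d : ℤ} (hd : Squarefree d)
    (hd4 : d % 4 = 2) {z : QuadraticAlgebra ℚ (d : ℚ) 0} (hz : IsIntegral ℤ z) :
    ∃ a b : ℤ, z.re = a ∧ z.im = b := by
  have hz' : IsIntegral ℤ (star z) :=
    hz.map ((starRingEnd (QuadraticAlgebra ℚ (d : ℚ) 0)).toIntAlgHom)
  have hinj : Function.Injective (algebraMap ℚ (QuadraticAlgebra ℚ (d : ℚ) 0)) :=
    QuadraticAlgebra.algebraMap_injective
  have descend : ∀ {q : ℚ}, IsIntegral ℤ (algebraMap ℚ (QuadraticAlgebra ℚ (d : ℚ) 0) q) →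
      ∃ m : ℤ, q = m := by
    intro q hq
    obtain ⟨m, hm⟩ := IsIntegrallyClosed.isIntegral_iff.mp
      ((isIntegral_algHom_iff
        (algebraMap ℚ (QuadraticAlgebra ℚ (d : ℚ) 0)).toIntAlgHom hinj).mp hq)
    exact ⟨m, by simpa using hm.symm⟩
  obtain ⟨t, ht⟩ := descend (q := z.trace) (by
    rw [QuadraticAlgebra.algebraMap_trace_eq_add_star]
    exact hz.add hz')
  obtain ⟨n, hn⟩ := descend (q := z.norm) (by
    rw [QuadraticAlgebra.algebraMap_norm_eq_mul_star]
    exact hz.mul hz')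
  refine exists_intCast_eq_of_trace_norm hd hd4 (t := t) (n := n) ?_ ?_
  · rw [← ht, QuadraticAlgebra.trace_def]; ring
  · rw [← hn, QuadraticAlgebra.norm_def]; ring

/-- If `x² = d` with `d ≡ 2 (mod 4)` squarefree, the ring of integers of `ℚ(x)` is `ℤ[√d]`. -/
theorem exists_algebra_isIntegralClosure {d : ℤ} (hd : Squarefree d) (hd4 : d % 4 = 2) {x : ℂ}
    (hx : x ^ 2 = d) :
    ∃ _ : Algebra (QuadraticAlgebra ℤ d 0) ℚ⟮x⟯,
      IsIntegralClosure (QuadraticAlgebra ℤ d 0) ℤ ℚ⟮x⟯ := by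
  have hfact : Fact (∀ r : ℚ, r ^ 2 ≠ (d : ℚ) + 0 * r) := ⟨by
    intro r hr
    rw [zero_mul, add_zero] at hr
    have h1 : IsSquare d := by
      rw [← Rat.isSquare_intCast_iff, ← hr]
      exact ⟨r, pow_two r⟩
    obtain ⟨s, rfl⟩ := h1
    have := (hd s dvd_rfl)
    rcases Int.isUnit_iff.mp this with rfl | rfl <;> simp at hd4⟩
  let ψ : QuadraticAlgebra ℚ (d : ℚ) 0 →ₐ[ℚ] ℂ :=
    QuadraticAlgebra.lift ⟨x, by simp [← pow_two, hx]⟩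
  have hψ : ∀ z, ψ z = z.re + z.im * x := by
    intro z
    simp [ψ, QuadraticAlgebra.lift, Algebra.smul_def]
    rfl
  have hψinj : Function.Injective ψ := ψ.toRingHom.injective
  have hle : ℚ⟮x⟯ ≤ ψ.fieldRange := by
    rw [IntermediateField.adjoin_simple_le_iff]
    exact ⟨QuadraticAlgebra.omega, by simp [hψ]⟩
  let s : ℚ⟮x⟯ := IntermediateField.AdjoinSimple.gen ℚ x
  have hs : (s : ℂ) = x := rfl
  let φ : QuadraticAlgebra ℤ d 0 →ₐ[ℤ] ℚ⟮x⟯ :=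
    QuadraticAlgebra.lift ⟨s, by
      apply Subtype.ext
      simp [hs, ← pow_two, hx]⟩
  have hφ : ∀ z : QuadraticAlgebra ℤ d 0, ((φ z : ℚ⟮x⟯) : ℂ) = ψ ⟨z.re, z.im⟩ := by
    intro z
    simp [φ, QuadraticAlgebra.lift, hψ, hs]
  refine ⟨(φ : _ →+* ℚ⟮x⟯).toAlgebra, ?_⟩
  let : Algebra (QuadraticAlgebra ℤ d 0) ℚ⟮x⟯ := (φ : _ →+* ℚ⟮x⟯).toAlgebra
  have halg : ∀ z, algebraMap (QuadraticAlgebra ℤ d 0) ℚ⟮x⟯ z = φ z := fun _ => rfl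
  refine ⟨?_, ?_⟩
  · intro z w hzw
    have h1 := congrArg (fun t : ℚ⟮x⟯ => (t : ℂ)) hzw
    simp only [halg, hφ] at h1
    have h2 := hψinj h1
    simp only [QuadraticAlgebra.mk.injEq, Int.cast_inj] at h2
    exact QuadraticAlgebra.ext h2.1 h2.2
  · intro y
    constructor
    · intro hy
      obtain ⟨z, hz⟩ := hle y.2
      have hz' : IsIntegral ℤ z := by
        have h1 : IsIntegral ℤ (y : ℂ) := hy.map (ℚ⟮x⟯.val.restrictScalars ℤ)
        have h2 : ψ.toRingHom.toIntAlgHom z = (y : ℂ) := hz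
        rw [← h2] at h1
        exact (isIntegral_algHom_iff ψ.toRingHom.toIntAlgHom hψinj).mp h1
      obtain ⟨a, b, ha, hb⟩ := QuadraticAlgebra.exists_intCast_eq_of_isIntegral hd hd4 hz'
      refine ⟨⟨a, b⟩, Subtype.ext ?_⟩
      rw [halg, hφ, ← hz]
      simp [hψ, ha, hb]
    · rintro ⟨z, rfl⟩
      have := Algebra.IsIntegral.isIntegral (R := ℤ) z
      exact this.map φ

theorem Ideal.span_pair_sq_of_isCoprime {R : Type*} [CommRing R] {q m w : R} (hw : w * w = q * m)
    (hqm : IsCoprime q m) : Ideal.span {q, w} ^ 2 = Ideal.span {q} := by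
  rw [pow_two, Ideal.span_pair_mul_span_pair]
  apply le_antisymm
  · rw [Ideal.span_le]
    rintro z (h | h | h | h) <;> rw [SetLike.mem_coe, h]
    · exact Ideal.mem_span_singleton.mpr ⟨q, rfl⟩
    · exact Ideal.mem_span_singleton.mpr ⟨w, rfl⟩
    · exact Ideal.mem_span_singleton.mpr ⟨w, mul_comm _ _⟩
    · exact Ideal.mem_span_singleton.mpr ⟨m, hw⟩
  · rw [Ideal.span_singleton_le_iff_mem]
    obtain ⟨u, v, huv⟩ := hqm
    have h1 : u * (q * q) + v * (w * w) = q := by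
      rw [hw]
      linear_combination q * huv
    have h2 : q * q ∈ Ideal.span {q * q, q * w, w * q, w * w} := Ideal.subset_span (by simp)
    have h3 : w * w ∈ Ideal.span {q * q, q * w, w * q, w * w} := Ideal.subset_span (by simp)
    have h4 := add_mem (Ideal.mul_mem_left _ u h2) (Ideal.mul_mem_left _ v h3)
    rwa [h1] at h4

namespace QuadraticAlgebra

variable {d : ℤ}

theorem natCast_dvd_iff {q : ℕ} {z : QuadraticAlgebra ℤ d 0} :
    (q : QuadraticAlgebra ℤ d 0) ∣ z ↔ (q : ℤ) ∣ z.re ∧ (q : ℤ) ∣ z.im := by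
  simpa using algebraMap_dvd_iff (a := d) (b := 0) (r := (q : ℤ)) (z := z)

theorem natCast_dvd_of_dvd_sq {q : ℕ} (hq : q.Prime) (hq2 : q ≠ 2) (hqd : ¬ (q : ℤ) ∣ d)
    {z : QuadraticAlgebra ℤ d 0} (hz : (q : QuadraticAlgebra ℤ d 0) ∣ z ^ 2) :
    (q : QuadraticAlgebra ℤ d 0) ∣ z := by
  have hq' : Prime (q : ℤ) := Nat.prime_iff_prime_int.mp hq
  rw [pow_two, natCast_dvd_iff] at hz
  simp only [re_mul, im_mul, zero_mul, add_zero] at hz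
  obtain ⟨h1, h2⟩ := hz
  have h3 : (q : ℤ) ∣ z.re ∨ (q : ℤ) ∣ z.im := by
    have : (q : ℤ) ∣ 2 * (z.re * z.im) := by convert h2 using 1; ring
    rcases hq'.dvd_or_dvd this with h | h
    · exact absurd ((Nat.prime_dvd_prime_iff_eq hq Nat.prime_two).mp (by exact_mod_cast h)) hq2
    · exact hq'.dvd_or_dvd h
  rw [natCast_dvd_iff]
  rcases h3 with h | h
  · refine ⟨h, ?_⟩
    have h4 : (q : ℤ) ∣ d * (z.im * z.im) := by
      have := (Int.dvd_add_right (h.mul_right z.re)).mp h1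
      rwa [mul_assoc] at this
    have h5 := (hq'.dvd_or_dvd h4).resolve_left hqd
    exact (hq'.dvd_or_dvd h5).elim id id
  · refine ⟨?_, h⟩
    have h5 := (Int.dvd_add_left (h.mul_left (d * z.im))).mp h1
    exact (hq'.dvd_or_dvd h5).elim id id

theorem absNorm_span_singleton [IsDedekindDomain (QuadraticAlgebra ℤ d 0)]
    (z : QuadraticAlgebra ℤ d 0) : Ideal.absNorm (Ideal.span {z}) = z.norm.natAbs := by
  rw [Ideal.absNorm_span_singleton, Algebra.norm_apply, ← det_toLinearMap_eq_norm]
  congr 2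

theorem charZero_int : CharZero (QuadraticAlgebra ℤ d 0) :=
  charZero_of_injective_algebraMap (algebraMap_injective (R := ℤ))

end QuadraticAlgebra

section ClassGroup

open nonZeroDivisors

variable {R : Type*} [CommRing R] [IsDedekindDomain R]

theorem mk0_eq_one_iff_exists_span (I : (Ideal R)⁰) :
    ClassGroup.mk0 I = 1 ↔ ∃ z, (I : Ideal R) = Ideal.span {z} :=
  (ClassGroup.mk0_eq_one_iff I.2).trans (Submodule.isPrincipal_iff _)

/-- A subgroup of the class group containing the classes of the ramified primes contains the class
of every ideal whose square is generated by a rational integer. -/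
theorem mk0_mem_of_sq_eq_span_natCast [CharZero R] {H : Subgroup (ClassGroup R)}
    (hdvd : ∀ a b : ℕ, (a : R) ∣ b → a ∣ b)
    (hH : ∀ q : ℕ, q.Prime → (∀ z : R, (q : R) ∣ z ^ 2 → (q : R) ∣ z) ∨
      ∃ P : (Ideal R)⁰, (P : Ideal R) ^ 2 = Ideal.span {(q : R)} ∧ ClassGroup.mk0 P ∈ H)
    (m : ℕ) (hm : m ≠ 0) (J : (Ideal R)⁰)
    (hJ : (J : Ideal R) ^ 2 = Ideal.span {(m : R)}) :
    ClassGroup.mk0 J ∈ H := by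
  induction m using Nat.strong_induction_on generalizing J with
  | _ m ih =>
  by_cases hm1 : m = 1
  · subst hm1
    have : J = 1 := by
      apply Subtype.ext
      refine pow_left_injective (M := Ideal R) two_ne_zero ?_
      simp [hJ, Ideal.top_pow]
    rw [this, map_one]
    exact H.one_mem
  obtain ⟨q, hq, k, rfl⟩ := Nat.exists_prime_and_dvd hm1
  have hk : k ≠ 0 := right_ne_zero_of_mul hm
  have hq0 : (q : R) ≠ 0 := by exact_mod_cast hq.ne_zero
  have hspan : Ideal.span {((q * k : ℕ) : R)} =
      Ideal.span {(q : R)} * Ideal.span {(k : R)} := by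
    rw [Ideal.span_singleton_mul_span_singleton, Nat.cast_mul]
  have hspan0 : Ideal.span {(q : R)} ≠ 0 := by simpa using hq.ne_zero
  rw [hspan] at hJ
  rcases hH q hq with hred | ⟨P, hP, hPH⟩
  · have hqJ : Ideal.span {(q : R)} ∣ J := by
      rw [Ideal.dvd_iff_le]
      intro z hz
      rw [Ideal.mem_span_singleton]
      refine hred z ?_
      rw [← Ideal.mem_span_singleton]
      have := Ideal.pow_mem_pow hz 2
      rw [hJ] at this
      have hle : Ideal.span {(q : R)} * Ideal.span {(k : R)} ≤ Ideal.span {(q : R)} :=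
        Ideal.mul_le_left
      exact hle this
    obtain ⟨K, hK⟩ := exists_eq_mul_right_of_dvd hqJ
    have hK0 : K ∈ (Ideal R)⁰ := by
      rw [mem_nonZeroDivisors_iff_ne_zero]
      rintro rfl
      exact nonZeroDivisors.ne_zero J.2 (by simpa using hK)
    have h1 : Ideal.span {(q : R)} * K ^ 2 = Ideal.span {(k : R)} := by
      apply mul_left_cancel₀ hspan0
      rw [← hJ, hK]
      ring
    have hqk : q ∣ k := by
      have h2 : (q : R) ∣ k := by
        rw [← Ideal.span_singleton_le_span_singleton, ← h1]
        exact Ideal.mul_le_left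
      exact hdvd _ _ h2
    obtain ⟨l, rfl⟩ := exists_eq_mul_right_of_dvd hqk
    have hl : l ≠ 0 := right_ne_zero_of_mul hk
    have hJK : ClassGroup.mk0 J = ClassGroup.mk0 ⟨K, hK0⟩ := by
      rw [ClassGroup.mk0_eq_mk0_iff]
      exact ⟨1, q, one_ne_zero, hq0, by simp [hK]⟩
    rw [hJK]
    refine ih l ?_ hl ⟨K, hK0⟩ ?_
    · calc l < q * l := lt_mul_of_one_lt_left (Nat.pos_of_ne_zero hl) hq.one_lt
        _ < q * (q * l) := lt_mul_of_one_lt_left (Nat.pos_of_ne_zero hk) hq.one_lt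
    · apply mul_left_cancel₀ hspan0
      rw [h1, Nat.cast_mul, Ideal.span_singleton_mul_span_singleton]
  · have hPJ : (P : Ideal R) ∣ J := by
      rw [← UniqueFactorizationMonoid.pow_dvd_pow_iff_dvd two_ne_zero, hJ, hP]
      exact dvd_mul_right _ _
    obtain ⟨K, hK⟩ := exists_eq_mul_right_of_dvd hPJ
    have hK0 : K ∈ (Ideal R)⁰ := by
      rw [mem_nonZeroDivisors_iff_ne_zero]
      rintro rfl
      exact nonZeroDivisors.ne_zero J.2 (by simpa using hK)
    have hJP : J = P * ⟨K, hK0⟩ := Subtype.ext hK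
    rw [hJP, map_mul]
    refine H.mul_mem hPH (ih k ?_ hk ⟨K, hK0⟩ ?_)
    · exact lt_mul_of_one_lt_left (Nat.pos_of_ne_zero hk) hq.one_lt
    · rw [hK, mul_pow, hP] at hJ
      exact mul_left_cancel₀ hspan0 hJ

/-- If `-1` is a norm, or if norms are nonnegative, every ideal class of exponent two is
represented by an ideal whose square is generated by a rational integer. -/
theorem exists_mk0_eq_of_sq_eq_one [CharZero R] [Module.Free ℤ R] [Module.Finite ℤ R] [StarRing R]
    {N : R →* ℤ} (hN : ∀ z, (N z : R) = z * star z)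
    (habs : ∀ z, Ideal.absNorm (Ideal.span {z}) = (N z).natAbs)
    (hunit : (∀ z, 0 ≤ N z) ∨ ∃ u, N u = -1)
    (g : ClassGroup R) (hg : g ^ 2 = 1) :
    ∃ (J : (Ideal R)⁰) (m : ℕ), m ≠ 0 ∧
      (J : Ideal R) ^ 2 = Ideal.span {(m : R)} ∧ ClassGroup.mk0 J = g := by
  obtain ⟨I, rfl⟩ := ClassGroup.mk0_surjective g
  have hI0 : (I : Ideal R) ≠ 0 := nonZeroDivisors.ne_zero I.2
  rw [← map_pow] at hg
  obtain ⟨β, hβ⟩ := (mk0_eq_one_iff_exists_span _).mp hg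
  rw [SubmonoidClass.coe_pow] at hβ
  set n := Ideal.absNorm (I : Ideal R) with hn
  have hn0 : n ≠ 0 := Ideal.absNorm_ne_zero_of_nonZeroDivisors I
  have hnorm : (N β).natAbs = n ^ 2 := by
    rw [← habs, ← hβ, map_pow]
  obtain ⟨α, hα, hαn⟩ : ∃ α : R,
      (I : Ideal R) ^ 2 = Ideal.span {α} ∧ N α = (n : ℤ) ^ 2 := by
    rcases Int.natAbs_eq (N β) with h | h <;> rw [hnorm] at h
    · exact ⟨β, hβ, by simpa using h⟩
    · rcases hunit with hd | ⟨u, hu⟩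
      · have h1 := hd β
        have h2 : (0 : ℤ) < (n : ℤ) ^ 2 := by positivity
        push_cast at h
        omega
      · refine ⟨u * β, ?_, by rw [map_mul, hu, h]; simp⟩
        have hu' : IsUnit u := IsUnit.of_mul_eq_one (-star u) (by
          rw [mul_neg, ← hN, hu]; simp)
        rw [hβ, Ideal.span_singleton_mul_left_unit hu']
  by_cases hδ : α + n = 0
  · refine ⟨I, n, hn0, ?_, rfl⟩
    rw [hα, eq_neg_of_add_eq_zero_left hδ, Ideal.span_singleton_neg]
  have hδ' : star (α + n) ≠ 0 := star_ne_zero.mpr hδ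
  have hJ0 : Ideal.span {star (α + n)} * (I : Ideal R) ∈
      (Ideal R)⁰ := by
    rw [mem_nonZeroDivisors_iff_ne_zero]
    exact mul_ne_zero (by simpa using hδ') hI0
  have hprod : (n : R) * (N (α + n) : ℤ) = star (α + n) ^ 2 * α := by
    have h1 := hN α
    rw [hαn] at h1
    rw [hN]
    push_cast at h1
    simp only [star_add, star_natCast]
    linear_combination (n + star α) * h1
  refine ⟨⟨_, hJ0⟩, n * (N (α + n)).natAbs, ?_, ?_, ?_⟩
  · refine mul_ne_zero hn0 (Int.natAbs_ne_zero.mpr fun h => ?_)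
    have h2 := hN (α + n)
    rw [h, Int.cast_zero] at h2
    exact (mul_ne_zero hδ hδ') h2.symm
  · have h3 : Ideal.span {(((N (α + n)).natAbs : ℕ) : R)} =
        Ideal.span {((N (α + n) : ℤ) : R)} := by
      rcases Int.natAbs_eq (N (α + n)) with h | h
      · nth_rw 2 [h]; simp
      · nth_rw 2 [h]; simp [Ideal.span_singleton_neg]
    rw [mul_pow, hα, Ideal.span_singleton_pow, Ideal.span_singleton_mul_span_singleton, ← hprod,
      ← Ideal.span_singleton_mul_span_singleton, ← h3, Ideal.span_singleton_mul_span_singleton,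
      Nat.cast_mul]
  · rw [ClassGroup.mk0_eq_mk0_iff]
    exact ⟨1, star (α + n), one_ne_zero, hδ', by simp⟩

theorem not_isSquare_mk0 [CharZero R] [Module.Free ℤ R] [Module.Finite ℤ R] {N : R →* ℤ}
    (habs : ∀ z, Ideal.absNorm (Ideal.span {z}) = (N z).natAbs)
    {q : ℕ} (hNq : N q = (q : ℤ) ^ 2)
    (hrep : ∀ (f n : ℤ) (z : R), f = 1 ∨ f = -1 → q * n ^ 2 = f * N z → n = 0)
    {P : (Ideal R)⁰}
    (hP : (P : Ideal R) ^ 2 = Ideal.span {(q : R)}) :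
    ¬ IsSquare (ClassGroup.mk0 P) := by
  rintro ⟨g, hg⟩
  obtain ⟨I, rfl⟩ := ClassGroup.mk0_surjective g
  have hP2 : ClassGroup.mk0 (P ^ 2) = 1 :=
    (mk0_eq_one_iff_exists_span _).mpr ⟨q, by rw [SubmonoidClass.coe_pow, hP]⟩
  have h1 : ClassGroup.mk0 (I * I * P) = 1 := by
    rw [map_mul, map_mul, ← hg, ← map_mul, ← pow_two, hP2]
  obtain ⟨α, hα⟩ := (mk0_eq_one_iff_exists_span _).mp h1
  rw [Submonoid.coe_mul, Submonoid.coe_mul] at hα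
  have hPq : Ideal.absNorm (P : Ideal R) = q := by
    have := congrArg Ideal.absNorm hP
    rw [map_pow, habs, hNq, Int.natAbs_pow, Int.natAbs_natCast] at this
    exact Nat.pow_left_injective two_ne_zero this
  have hI0 : Ideal.absNorm (I : Ideal R) ≠ 0 :=
    Ideal.absNorm_ne_zero_of_nonZeroDivisors I
  have h2 := congrArg Ideal.absNorm hα
  rw [map_mul, map_mul, hPq, habs] at h2
  apply hI0
  rcases Int.natAbs_eq (N α) with h | h <;> rw [← h2] at h <;> push_cast at h
  · exact_mod_cast hrep 1 (Ideal.absNorm (I : Ideal R)) α (Or.inl rfl) (by rw [h]; ring)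
  · exact_mod_cast hrep (-1) (Ideal.absNorm (I : Ideal R)) α (Or.inr rfl) (by rw [h]; ring)

theorem exists_classGroup_generators [CharZero R] [Module.Free ℤ R] [Module.Finite ℤ R] [StarRing R]
    {N : R →* ℤ} (hN : ∀ z, (N z : R) = z * star z)
    (habs : ∀ z, Ideal.absNorm (Ideal.span {z}) = (N z).natAbs)
    (hunit : (∀ z, 0 ≤ N z) ∨ ∃ u, N u = -1)
    (hNn : ∀ n : ℕ, N n = (n : ℤ) ^ 2) (hdvd : ∀ a b : ℕ, (a : R) ∣ b → a ∣ b)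
    {q₁ q₂ : ℕ} (hq₁ : q₁ ≠ 0) (hq₂ : q₂ ≠ 0)
    (hred : ∀ q : ℕ, q.Prime → q ≠ 2 → q ≠ q₁ → q ≠ q₂ → ∀ z : R, (q : R) ∣ z ^ 2 → (q : R) ∣ z)
    (hram : ∀ q : ℕ, q = 2 ∨ q = q₁ ∨ q = q₂ → ∃ P : Ideal R, P ^ 2 = Ideal.span {(q : R)})
    (hrep : ∀ q : ℕ, q = 2 ∨ q = q₁ ∨ q = q₂ → ∀ (f n : ℤ) (z : R), f = 1 ∨ f = -1 →
      q * n ^ 2 = f * N z → n = 0)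
    {w : R} (hw : Ideal.span {w} ^ 2 = Ideal.span {((2 * q₁ * q₂ : ℕ) : R)}) :
    ∃ a b : ClassGroup R, a ^ 2 = 1 ∧ b ^ 2 = 1 ∧ ¬ IsSquare a ∧ ¬ IsSquare b ∧
      ¬ IsSquare (a * b) ∧ ∀ g : ClassGroup R, g ^ 2 = 1 → g ∈ Subgroup.closure {a, b} := by
  have hram' : ∀ q : ℕ, q ≠ 0 → q = 2 ∨ q = q₁ ∨ q = q₂ →
      ∃ P : (Ideal R)⁰, (P : Ideal R) ^ 2 = Ideal.span {(q : R)} := by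
    intro q hq0 hq
    obtain ⟨P, hP⟩ := hram q hq
    refine ⟨⟨P, mem_nonZeroDivisors_iff_ne_zero.mpr ?_⟩, hP⟩
    rintro rfl
    rw [zero_pow two_ne_zero, eq_comm, Ideal.zero_eq_bot, Ideal.span_singleton_eq_bot] at hP
    exact hq0 (by exact_mod_cast hP)
  have hsq : ∀ {q : ℕ} {P : (Ideal R)⁰}, (P : Ideal R) ^ 2 = Ideal.span {(q : R)} →
      ClassGroup.mk0 P ^ 2 = 1 := by
    intro q P hP
    rw [← map_pow, mk0_eq_one_iff_exists_span]
    exact ⟨q, by rw [SubmonoidClass.coe_pow, hP]⟩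
  obtain ⟨A, hA⟩ := hram' 2 two_ne_zero (Or.inl rfl)
  obtain ⟨B, hB⟩ := hram' q₁ hq₁ (Or.inr (Or.inl rfl))
  obtain ⟨C, hC⟩ := hram' q₂ hq₂ (Or.inr (Or.inr rfl))
  have hABC : ClassGroup.mk0 A * ClassGroup.mk0 B * ClassGroup.mk0 C = 1 := by
    rw [← map_mul, ← map_mul, mk0_eq_one_iff_exists_span]
    refine ⟨w, pow_left_injective (M := Ideal R) two_ne_zero ?_⟩
    simp only [Submonoid.coe_mul, mul_pow, hA, hB, hC, hw, Ideal.span_singleton_mul_span_singleton,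
      Nat.cast_mul]
  have hAB : ClassGroup.mk0 A * ClassGroup.mk0 B = ClassGroup.mk0 C := by
    rw [eq_inv_of_mul_eq_one_left hABC, inv_eq_iff_mul_eq_one, ← pow_two, hsq hC]
  refine ⟨ClassGroup.mk0 A, ClassGroup.mk0 B, hsq hA, hsq hB,
    not_isSquare_mk0 habs (hNn 2) (hrep 2 (Or.inl rfl)) hA,
    not_isSquare_mk0 habs (hNn q₁) (hrep q₁ (Or.inr (Or.inl rfl))) hB, ?_, ?_⟩
  · rw [hAB]
    exact not_isSquare_mk0 habs (hNn q₂) (hrep q₂ (Or.inr (Or.inr rfl))) hC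
  · intro g hg
    obtain ⟨J, m, hm, hJ, rfl⟩ := exists_mk0_eq_of_sq_eq_one hN habs hunit g hg
    have hAmem : ClassGroup.mk0 A ∈ Subgroup.closure {ClassGroup.mk0 A, ClassGroup.mk0 B} :=
      Subgroup.subset_closure (by simp)
    have hBmem : ClassGroup.mk0 B ∈ Subgroup.closure {ClassGroup.mk0 A, ClassGroup.mk0 B} :=
      Subgroup.subset_closure (by simp)
    refine mk0_mem_of_sq_eq_span_natCast hdvd (fun q hq => ?_) m hm J hJ
    by_cases h2 : q = 2
    · subst h2
      exact Or.inr ⟨A, hA, hAmem⟩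
    by_cases h₁ : q = q₁
    · subst h₁
      exact Or.inr ⟨B, hB, hBmem⟩
    by_cases h₂ : q = q₂
    · subst h₂
      exact Or.inr ⟨C, hC, hAB ▸ mul_mem hAmem hBmem⟩
    exact Or.inl (hred q hq h2 h₁ h₂)

end ClassGroup

namespace IsRadicand

variable {p₁ p₂ : ℕ} {d : ℤ}

theorem natAbs_eq (h : IsRadicand p₁ p₂ d) : d.natAbs = 2 * p₁ * p₂ := by
  rcases h.eq with h | h <;> simp [h, Int.natAbs_mul]

theorem squarefree (h : IsRadicand p₁ p₂ d) : Squarefree d := by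
  have h₁ : Nat.Coprime 2 p₁ := by
    rw [Nat.coprime_primes Nat.prime_two h.prime₁]
    rintro rfl
    exact absurd h.mod₁ (by norm_num)
  have h₂ : Nat.Coprime 2 p₂ := by
    rw [Nat.coprime_primes Nat.prime_two h.prime₂]
    rintro rfl
    exact absurd h.mod₂ (by norm_num)
  have h₁₂ : Nat.Coprime p₁ p₂ := (Nat.coprime_primes h.prime₁ h.prime₂).mpr h.ne
  rw [← Int.squarefree_natAbs, h.natAbs_eq, Nat.squarefree_mul (h₂.mul_left h₁₂),
    Nat.squarefree_mul h₁]
  exact ⟨⟨Nat.prime_two.prime.squarefree, h.prime₁.prime.squarefree⟩,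
    h.prime₂.prime.squarefree⟩

theorem emod_four (h : IsRadicand p₁ p₂ d) : d % 4 = 2 := by
  have h₁ := h.mod₁
  have h₂ := h.mod₂
  have h₁₂ : p₁ * p₂ % 2 = 1 := Nat.odd_iff.mp
    (Nat.odd_mul.mpr ⟨Nat.odd_iff.mpr (by omega), Nat.odd_iff.mpr (by omega)⟩)
  have h3 := h.natAbs_eq
  rw [mul_assoc] at h3
  omega

theorem dvd_iff (h : IsRadicand p₁ p₂ d) {q : ℕ} (hq : q.Prime) :
    (q : ℤ) ∣ d ↔ q = 2 ∨ q = p₁ ∨ q = p₂ := by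
  rw [Int.natCast_dvd, h.natAbs_eq, hq.dvd_mul, hq.dvd_mul,
    Nat.prime_dvd_prime_iff_eq hq Nat.prime_two, Nat.prime_dvd_prime_iff_eq hq h.prime₁,
    Nat.prime_dvd_prime_iff_eq hq h.prime₂, or_assoc]

theorem exists_eq_mul (h : IsRadicand p₁ p₂ d) {q : ℕ} (hq : q = 2 ∨ q = p₁ ∨ q = p₂) :
    ∃ m : ℤ, d = q * m ∧ IsCoprime (q : ℤ) m := by
  have hqp : q.Prime := by
    rcases hq with rfl | rfl | rfl
    exacts [Nat.prime_two, h.prime₁, h.prime₂]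
  obtain ⟨m, rfl⟩ := (h.dvd_iff hqp).mpr hq
  refine ⟨m, rfl, ?_⟩
  have hqi : Prime (q : ℤ) := Nat.prime_iff_prime_int.mp hqp
  rw [hqi.coprime_iff_not_dvd]
  exact fun hm => hqi.not_isUnit (h.squarefree _ (mul_dvd_mul_left _ hm))

theorem exists_classGroup_generators (h : IsRadicand p₁ p₂ d)
    [IsDedekindDomain (QuadraticAlgebra ℤ d 0)] :
    ∃ a b : ClassGroup (QuadraticAlgebra ℤ d 0), a ^ 2 = 1 ∧ b ^ 2 = 1 ∧ ¬ IsSquare a ∧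
      ¬ IsSquare b ∧ ¬ IsSquare (a * b) ∧
      ∀ g : ClassGroup (QuadraticAlgebra ℤ d 0), g ^ 2 = 1 → g ∈ Subgroup.closure {a, b} := by
  have := QuadraticAlgebra.charZero_int (d := d)
  refine _root_.exists_classGroup_generators (N := QuadraticAlgebra.norm) (q₁ := p₁) (q₂ := p₂)
    (w := QuadraticAlgebra.omega) ?_ QuadraticAlgebra.absNorm_span_singleton ?_ ?_ ?_
    h.prime₁.ne_zero h.prime₂.ne_zero ?_ ?_ ?_ ?_
  · intro z
    simpa using QuadraticAlgebra.algebraMap_norm_eq_mul_star z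
  · rcases le_or_gt d 0 with hd | hd
    · left
      intro z
      rw [QuadraticAlgebra.norm_def]
      nlinarith [mul_self_nonneg z.re, mul_self_nonneg z.im]
    · right
      obtain ⟨t, u, htu⟩ := h.exists_pell_neg_one hd
      refine ⟨⟨t, u⟩, ?_⟩
      rw [QuadraticAlgebra.norm_def, ← htu]
      ring
  · exact QuadraticAlgebra.norm_natCast
  · intro a b hab
    simpa [Int.natCast_dvd_natCast] using (QuadraticAlgebra.natCast_dvd_iff.mp hab).1
  · intro q hq hq2 hq₁ hq₂ z
    exact QuadraticAlgebra.natCast_dvd_of_dvd_sq hq hq2 (by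
      rw [h.dvd_iff hq]
      tauto)
  · intro q hq
    obtain ⟨m, hm, hqm⟩ := h.exists_eq_mul hq
    refine ⟨_, Ideal.span_pair_sq_of_isCoprime (m := (m : QuadraticAlgebra ℤ d 0))
      (w := QuadraticAlgebra.omega) ?_ ?_⟩
    · rw [QuadraticAlgebra.omega_mul_omega_eq_mk]
      ext <;> simp [hm]
    · simpa using hqm.map (Int.castRingHom (QuadraticAlgebra ℤ d 0))
  · intro q hq f n z hf hn
    have hz : z.norm = z.re ^ 2 - d * z.im ^ 2 := by rw [QuadraticAlgebra.norm_def]; ring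
    rw [hz] at hn
    rcases hq with rfl | rfl | rfl
    · exact h.eq_zero_of_two_mul_sq_eq hf (by exact_mod_cast hn)
    · exact h.eq_zero_of_prime_mul_sq_eq hf hn
    · exact h.symm.eq_zero_of_prime_mul_sq_eq hf hn
  · rw [Ideal.span_singleton_pow, pow_two, QuadraticAlgebra.omega_mul_omega_eq_mk]
    have hd : (⟨d, 0⟩ : QuadraticAlgebra ℤ d 0) = (d : QuadraticAlgebra ℤ d 0) := by
      ext <;> simp
    rw [hd]
    rcases h.eq with hd | hd <;> rw [hd] <;> simp [Ideal.span_singleton_neg]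

theorem nonempty_sylow_equiv (h : IsRadicand p₁ p₂ d) {x : ℂ} (hx : x ^ 2 = d)
    [NumberField ℚ⟮x⟯] (P : Sylow 2 (ClassGroup (𝓞 ℚ⟮x⟯))) :
    Nonempty (Additive P ≃+ (ZMod 2 × ZMod 2)) := by
  obtain ⟨_, _⟩ := exists_algebra_isIntegralClosure h.squarefree h.emod_four hx
  let e : 𝓞 ℚ⟮x⟯ ≃+* QuadraticAlgebra ℤ d 0 := RingOfIntegers.equiv _
  have : IsDomain (QuadraticAlgebra ℤ d 0) := e.symm.toMulEquiv.isDomain _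
  have : IsDedekindDomain (QuadraticAlgebra ℤ d 0) :=
    IsIntegralClosure.isDedekindDomain ℤ ℚ ℚ⟮x⟯ _
  obtain ⟨a, b, ha, hb, ha', hb', hab', htors⟩ := h.exists_classGroup_generators
  exact sylow_two_equiv_of_mulEquiv (ClassGroup.mulEquiv e) ha hb ha' hb' hab' htors P

end IsRadicand

/-- For distinct primes `p₁ ≡ p₂ ≡ 5 (mod 8)`, the 2-Sylow subgroups of the
ideal class groups of `ℚ(√(2p₁p₂))` and of `ℚ(√(-2p₁p₂))` are both isomorphic to
`ℤ/2ℤ × ℤ/2ℤ`. The quadratic fields are realized as the subfields of `ℂ` generated by a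
square root `x` of `2p₁p₂`, resp. a square root `y` of `-2p₁p₂`. -/
theorem stmt_0 (p₁ p₂ : ℕ) (hp₁ : p₁.Prime) (hp₂ : p₂.Prime) (hne : p₁ ≠ p₂)
    (hm₁ : p₁ % 8 = 5) (hm₂ : p₂ % 8 = 5)
    (x y : ℂ) (hx : x ^ 2 = ((2 * p₁ * p₂ : ℕ) : ℂ)) (hy : y ^ 2 = -((2 * p₁ * p₂ : ℕ) : ℂ))
    [NumberField ℚ⟮x⟯] [NumberField ℚ⟮y⟯] :
    (∀ P : Sylow 2 (ClassGroup (RingOfIntegers ℚ⟮x⟯)),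
      Nonempty (Additive P ≃+ (ZMod 2 × ZMod 2))) ∧
    (∀ Q : Sylow 2 (ClassGroup (RingOfIntegers ℚ⟮y⟯)),
      Nonempty (Additive Q ≃+ (ZMod 2 × ZMod 2))) := by
  refine ⟨fun P => ?_, fun Q => ?_⟩
  · exact IsRadicand.nonempty_sylow_equiv ⟨hp₁, hp₂, hne, hm₁, hm₂, Or.inl rfl⟩
      (by rw [hx]; push_cast; rfl) P
  · exact IsRadicand.nonempty_sylow_equiv ⟨hp₁, hp₂, hne, hm₁, hm₂, Or.inr rfl⟩
      (by rw [hy]; push_cast; rfl) Q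
end

section
/- The 2-Sylow subgroup Cl₂(𝕜) of the ideal class group of 𝕜 = ℚ(√(2p₁p₂), i) is isomorphic to ℤ/2ℤ × ℤ/2ℤ × ℤ/2ℤ. -/
open NumberField IntermediateField

local notation "ℤi" => GaussianInt

/-- `B` is a Dedekind quadratic extension of `ℤ[i]`, generated up to denominators dividing `2 * d`
by a square root `s` of `d`. -/
structure IsGaussianQuadratic (B : Type*) [CommRing B] [IsDedekindDomain B] [Algebra ℤi B]
    (d : ℤi) (s : B) : Prop where
  sq : s ^ 2 = algebraMap ℤi B d
  ne_zero : d ≠ 0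
  indep : ∀ a b : ℤi, algebraMap ℤi B a + algebraMap ℤi B b * s = 0 → a = 0 ∧ b = 0
  span : ∀ x : B, ∃ a b : ℤi,
    algebraMap ℤi B (2 * d) * x = algebraMap ℤi B a + algebraMap ℤi B b * s
  norm : ∃ N : Ideal B →* Ideal ℤi, ∀ a b : ℤi,
    N (Ideal.span {algebraMap ℤi B a + algebraMap ℤi B b * s}) = Ideal.span {a ^ 2 - d * b ^ 2}

/-- The ideal class `c` contains an integral ideal whose square is generated by `m`. -/
def HasSquare {B : Type*} [CommRing B] [IsDedekindDomain B] [Algebra ℤi B]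
    (c : ClassGroup B) (m : ℤi) : Prop :=
  ∃ A : nonZeroDivisors (Ideal B), ClassGroup.mk0 A = c ∧
    (A : Ideal B) ^ 2 = Ideal.span {algebraMap ℤi B m}

lemma gaussianInt_unit {u : ℤi} (hu : IsUnit u) :
    ∃ w : ℤi, IsUnit w ∧ (u = w ^ 2 ∨ u = ⟨0, 1⟩ * w ^ 2) := by
  have h1 : Zsqrtd.norm u = 1 := (Zsqrtd.norm_eq_one_iff' (by norm_num) u).2 hu
  have hi : IsUnit (⟨0, 1⟩ : ℤi) := (Zsqrtd.norm_eq_one_iff' (by norm_num) _).1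
    (by simp [Zsqrtd.norm_def])
  obtain ⟨a, b⟩ := u
  rw [Zsqrtd.norm_def] at h1
  simp only at h1
  have ha : a ^ 2 ≤ 1 := by nlinarith [sq_nonneg b]
  have hb : b ^ 2 ≤ 1 := by nlinarith [sq_nonneg a]
  have ha' := abs_le.1 (sq_le_one_iff_abs_le_one a |>.1 ha)
  have hb' := abs_le.1 (sq_le_one_iff_abs_le_one b |>.1 hb)
  obtain ⟨ha1, ha2⟩ := ha'
  obtain ⟨hb1, hb2⟩ := hb'
  interval_cases a <;> interval_cases b <;> simp at h1
  · exact ⟨_, hi, Or.inl (by ext <;> simp [sq])⟩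
  · exact ⟨_, hi, Or.inr (by ext <;> simp [sq])⟩
  · exact ⟨1, isUnit_one, Or.inr (by ext <;> simp)⟩
  · exact ⟨1, isUnit_one, Or.inl (by ext <;> simp)⟩

section ideals

variable {B : Type*} [CommRing B] [IsDedekindDomain B] [Algebra ℤi B]

lemma ideal_sq_injective {S : Type*} [CommRing S] [IsDedekindDomain S] {I J : Ideal S}
    (h : I ^ 2 = J ^ 2) : I = J :=
  dvd_antisymm ((UniqueFactorizationMonoid.pow_dvd_pow_iff_dvd two_ne_zero).1 h.dvd)
    ((UniqueFactorizationMonoid.pow_dvd_pow_iff_dvd two_ne_zero).1 h.symm.dvd)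

omit [Algebra ℤi B] in
lemma mk0_sq_eq_one_iff {A : nonZeroDivisors (Ideal B)} :
    ClassGroup.mk0 A ^ 2 = 1 ↔ ∃ γ : B, (A : Ideal B) ^ 2 = Ideal.span {γ} := by
  have h : (A : Ideal B) ^ 2 ∈ nonZeroDivisors (Ideal B) := pow_mem A.2 2
  have h2 : ClassGroup.mk0 A ^ 2 = ClassGroup.mk0 ⟨_, h⟩ := by
    rw [← map_pow]; rfl
  rw [h2, ClassGroup.mk0_eq_one_iff h]
  exact ⟨fun ⟨⟨γ, hγ⟩⟩ ↦ ⟨γ, hγ⟩, fun ⟨γ, hγ⟩ ↦ ⟨⟨γ, hγ⟩⟩⟩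

namespace HasSquare

lemma unique {c c' : ClassGroup B} {m : ℤi} (h : HasSquare c m) (h' : HasSquare c' m) :
    c = c' := by
  obtain ⟨A, rfl, hA⟩ := h
  obtain ⟨A', rfl, hA'⟩ := h'
  congr 1
  exact Subtype.ext (ideal_sq_injective (hA.trans hA'.symm))

lemma mul {c c' : ClassGroup B} {m m' : ℤi} (h : HasSquare c m) (h' : HasSquare c' m') :
    HasSquare (c * c') (m * m') := by
  obtain ⟨A, rfl, hA⟩ := h
  obtain ⟨A', rfl, hA'⟩ := h'
  refine ⟨A * A', map_mul _ _ _, ?_⟩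
  rw [Submonoid.coe_mul, mul_pow, hA, hA', Ideal.span_singleton_mul_span_singleton, map_mul]

lemma one : HasSquare (1 : ClassGroup B) 1 :=
  ⟨1, map_one _, by simp⟩

lemma sq_eq_one {c : ClassGroup B} {m : ℤi} (h : HasSquare c m) : c ^ 2 = 1 := by
  obtain ⟨A, rfl, hA⟩ := h
  exact mk0_sq_eq_one_iff.2 ⟨_, hA⟩

lemma of_associated {c : ClassGroup B} {m m' : ℤi} (h : HasSquare c m) (hm : Associated m m') :
    HasSquare c m' := by
  obtain ⟨A, rfl, hA⟩ := h
  refine ⟨A, rfl, hA.trans ?_⟩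
  rw [Ideal.span_singleton_eq_span_singleton]
  exact hm.map (algebraMap ℤi B)

lemma of_isPrincipal {β : B} (hβ : β ≠ 0) {m : ℤi}
    (h : Associated (β ^ 2) (algebraMap ℤi B m)) : HasSquare (1 : ClassGroup B) m := by
  have h0 : Ideal.span {β} ∈ nonZeroDivisors (Ideal B) :=
    mem_nonZeroDivisors_of_ne_zero (by simpa using hβ)
  refine ⟨⟨_, h0⟩, (ClassGroup.mk0_eq_one_iff h0).2 ⟨⟨_, rfl⟩⟩, ?_⟩
  simpa [Ideal.span_singleton_pow, Ideal.span_singleton_eq_span_singleton] using h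

lemma ne_zero {c : ClassGroup B} {m : ℤi} (h : HasSquare c m) : m ≠ 0 := by
  rintro rfl
  obtain ⟨A, -, hA⟩ := h
  have := nonZeroDivisors.ne_zero A.2
  simp only [map_zero, Ideal.span_singleton_zero, ← Ideal.zero_eq_bot] at hA
  exact this (pow_eq_zero_iff two_ne_zero |>.1 hA)

lemma of_sq_mul [FaithfulSMul ℤi B] {c : ClassGroup B} {r m : ℤi}
    (h : HasSquare c (r ^ 2 * m)) : HasSquare c m := by
  have h0 := h.ne_zero
  obtain ⟨A, rfl, hA⟩ := h
  have hr : r ≠ 0 := by rintro rfl; simp at h0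
  have hr' : algebraMap ℤi B r ≠ 0 := by simpa using hr
  have : Ideal.span {algebraMap ℤi B r} ∣ (A : Ideal B) := by
    rw [← UniqueFactorizationMonoid.pow_dvd_pow_iff_dvd two_ne_zero, hA, Ideal.span_singleton_pow,
      ← map_pow, map_mul,
      ← Ideal.span_singleton_mul_span_singleton]
    exact dvd_mul_right _ _
  obtain ⟨A', hA'⟩ := this
  have hr0 : Ideal.span {algebraMap ℤi B r} ≠ 0 := by simpa using hr
  have hA0 : A' ∈ nonZeroDivisors (Ideal B) := by
    refine mem_nonZeroDivisors_of_ne_zero ?_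
    rintro rfl
    exact nonZeroDivisors.ne_zero A.2 (by simpa using hA')
  refine ⟨⟨A', hA0⟩, ?_, ?_⟩
  · rw [ClassGroup.mk0_eq_mk0_iff]
    exact ⟨_, 1, hr', one_ne_zero, by simp [hA']⟩
  · refine mul_left_cancel₀ (pow_ne_zero 2 hr0) ?_
    rw [← mul_pow, ← hA', hA, Ideal.span_singleton_pow, Ideal.span_singleton_mul_span_singleton,
      map_mul, map_pow]

end HasSquare

namespace IsGaussianQuadratic

variable {d : ℤi} {s : B} (H : IsGaussianQuadratic B d s)
include H

lemma faithfulSMul : FaithfulSMul ℤi B := by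
  rw [faithfulSMul_iff_algebraMap_injective, injective_iff_map_eq_zero]
  intro a ha
  exact (H.indep a 0 (by simp [ha])).1

lemma form_ne_zero {a b : ℤi} (h : algebraMap ℤi B a + algebraMap ℤi B b * s ≠ 0) :
    a ^ 2 - d * b ^ 2 ≠ 0 := by
  intro h0
  have h1 : (algebraMap ℤi B a + algebraMap ℤi B b * s) *
      (algebraMap ℤi B a + algebraMap ℤi B (-b) * s) = 0 := by
    have : algebraMap ℤi B (a ^ 2 - d * b ^ 2) = 0 := by rw [h0, map_zero]
    rw [← this, map_sub, map_mul, ← H.sq]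
    simp only [map_pow, map_neg]
    ring
  rcases mul_eq_zero.1 h1 with h2 | h2
  · exact h h2
  · obtain ⟨rfl, h3⟩ := H.indep _ _ h2
    obtain rfl : b = 0 := by simpa using h3
    simp at h

/-- A class whose square contains a square root of `e` yields a norm equation. -/
lemma exists_norm_eq {c : ClassGroup B} {e : ℤi} (h : HasSquare (c ^ 2) e) :
    ∃ X Y Z u : ℤi, IsUnit u ∧ Z ≠ 0 ∧ e * (X ^ 2 - d * Y ^ 2) = u * Z ^ 2 := by
  have := H.faithfulSMul
  have he0 := h.ne_zero
  obtain ⟨E, hEc, hE⟩ := h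
  obtain ⟨A, rfl⟩ := ClassGroup.mk0_surjective c
  obtain ⟨N, hN⟩ := H.norm
  rw [← map_pow, ClassGroup.mk0_eq_mk0_iff] at hEc
  obtain ⟨y, x, hy, hx, hxy⟩ := hEc
  have h2d : algebraMap ℤi B (2 * d) ≠ 0 := by simpa using H.ne_zero
  obtain ⟨a, b, hab⟩ := H.span x
  obtain ⟨a', b', hab'⟩ := H.span y
  have hx' := H.form_ne_zero (hab ▸ mul_ne_zero h2d hx)
  have hy' := H.form_ne_zero (hab' ▸ mul_ne_zero h2d hy)
  have key : Ideal.span {algebraMap ℤi B a' + algebraMap ℤi B b' * s} * (E : Ideal B) =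
      Ideal.span {algebraMap ℤi B a + algebraMap ℤi B b * s} * (A : Ideal B) ^ 2 := by
    rw [← hab, ← hab', ← Ideal.span_singleton_mul_span_singleton,
      ← Ideal.span_singleton_mul_span_singleton, mul_assoc, mul_assoc, hxy]
    rfl
  have hNe : N (Ideal.span {algebraMap ℤi B e}) = Ideal.span {e} ^ 2 := by
    have := hN e 0
    simpa [Ideal.span_singleton_pow] using this
  have key2 := congrArg N key
  rw [map_mul, map_mul, hN, hN, map_pow] at key2
  have hEe : N E = Ideal.span {e} := by
    apply ideal_sq_injective
    rw [← map_pow, hE, hNe]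
  obtain ⟨z, hz⟩ := (IsPrincipalIdealRing.principal (N (A : Ideal B))).principal
  rw [hEe, hz, Ideal.submodule_span_eq, Ideal.span_singleton_pow,
    Ideal.span_singleton_mul_span_singleton, Ideal.span_singleton_mul_span_singleton,
    Ideal.span_singleton_eq_span_singleton] at key2
  obtain ⟨u, hu⟩ := key2.symm
  refine ⟨a * a' + d * b * b', a * b' + a' * b, (a ^ 2 - d * b ^ 2) * z, u, u.isUnit, ?_, ?_⟩
  · refine mul_ne_zero hx' ?_
    rintro rfl
    simp [hy', he0] at hu
  · linear_combination (-(a ^ 2 - d * b ^ 2)) * hu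

/-- If `i` is not a norm, every class killed by `2` contains a square root of a Gaussian integer. -/
lemma exists_hasSquare {c : ClassGroup B} (hc : c ^ 2 = 1)
    (hi : ∀ X Y Z : ℤi, X ^ 2 - d * Y ^ 2 = ⟨0, 1⟩ * Z ^ 2 → Z = 0) :
    ∃ m, HasSquare c m := by
  have := H.faithfulSMul
  obtain ⟨A, rfl⟩ := ClassGroup.mk0_surjective c
  obtain ⟨N, hN⟩ := H.norm
  obtain ⟨γ, hγ⟩ := mk0_sq_eq_one_iff.1 hc
  have hγ0 : γ ≠ 0 := by
    rintro rfl
    have := nonZeroDivisors.ne_zero A.2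
    simp only [Ideal.span_singleton_zero, ← Ideal.zero_eq_bot] at hγ
    exact this (pow_eq_zero_iff two_ne_zero |>.1 hγ)
  obtain ⟨a, b, hab⟩ := H.span γ
  have h2d : algebraMap ℤi B (2 * d) ≠ 0 := by simpa using H.ne_zero
  have h0 := H.form_ne_zero (hab ▸ mul_ne_zero h2d hγ0)
  have hNe : N (Ideal.span {algebraMap ℤi B (2 * d)}) = Ideal.span {2 * d} ^ 2 := by
    have := hN (2 * d) 0
    rw [Ideal.span_singleton_pow]
    simpa using this
  obtain ⟨z, hz⟩ := (IsPrincipalIdealRing.principal (N (A : Ideal B))).principal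
  have key := hN a b
  rw [← hab, ← Ideal.span_singleton_mul_span_singleton, map_mul, ← hγ, map_pow, hz, hNe,
    Ideal.submodule_span_eq, ← mul_pow, Ideal.span_singleton_mul_span_singleton,
    Ideal.span_singleton_pow, Ideal.span_singleton_eq_span_singleton] at key
  obtain ⟨u, hu⟩ := key
  obtain ⟨Z, hZ⟩ : ∃ Z, a ^ 2 - d * b ^ 2 = Z ^ 2 := by
    obtain ⟨w, -, hw | hw⟩ := gaussianInt_unit u.isUnit
    · exact ⟨(2 * d * z) * w, by rw [← hu, hw]; ring⟩
    · have := hi a b (2 * d * z * w) (by rw [← hu, hw]; ring)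
      refine (h0 ?_).elim
      rw [← hu, hw]
      linear_combination (2 * d * z * w * ⟨0, 1⟩) * this
  have hZ0 : Z ≠ 0 := by rintro rfl; simp [hZ] at h0
  obtain ⟨Z, hZ, haZ⟩ : ∃ Z, a ^ 2 - d * b ^ 2 = Z ^ 2 ∧ a + Z ≠ 0 := by
    by_cases h : a + Z = 0
    · refine ⟨-Z, by rw [hZ]; ring, fun h' ↦ hZ0 ?_⟩
      have h2 : 2 * Z = 0 := by linear_combination h - h'
      simpa using h2
    · exact ⟨Z, hZ, h⟩
  set δ : B := algebraMap ℤi B (a + Z) + algebraMap ℤi B b * s with hδ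
  set m : ℤi := 2 * (a + Z) * (2 * d) with hm
  have hm0 : algebraMap ℤi B m ≠ 0 := by
    rw [Ne, map_eq_zero_iff _ (FaithfulSMul.algebraMap_injective ℤi B)]
    simp [hm, haZ, H.ne_zero]
  have hδm : δ ^ 2 = algebraMap ℤi B m * γ := by
    have hZ' : algebraMap ℤi B a ^ 2 - algebraMap ℤi B d * algebraMap ℤi B b ^ 2 =
      algebraMap ℤi B Z ^ 2 := by simp only [← map_pow, ← map_mul, ← map_sub, hZ]
    rw [hm, map_mul, mul_assoc, hab, hδ]
    simp only [map_add, map_mul, map_ofNat]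
    linear_combination (algebraMap ℤi B b ^ 2) * H.sq - hZ'
  have hδ0 : δ ≠ 0 := by
    rintro h
    rw [h] at hδm
    exact mul_ne_zero hm0 hγ0 (by rw [← hδm]; simp)
  have hsq : (Ideal.span {algebraMap ℤi B m} * (A : Ideal B)) ^ 2 =
      Ideal.span {δ} ^ 2 * Ideal.span {algebraMap ℤi B m} := by
    rw [mul_pow, hγ, Ideal.span_singleton_pow, Ideal.span_singleton_pow, hδm,
      Ideal.span_singleton_mul_span_singleton, Ideal.span_singleton_mul_span_singleton]
    ring_nf
  obtain ⟨A', hA'⟩ := (UniqueFactorizationMonoid.pow_dvd_pow_iff_dvd two_ne_zero).1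
    (Dvd.intro _ hsq.symm)
  have hδ1 : Ideal.span {δ} ≠ 0 := by simpa using hδ0
  have hA0 : A' ∈ nonZeroDivisors (Ideal B) := by
    refine mem_nonZeroDivisors_of_ne_zero ?_
    rintro rfl
    rw [mul_zero, mul_eq_zero] at hA'
    rcases hA' with h | h
    · exact hm0 (by simpa using h)
    · exact nonZeroDivisors.ne_zero A.2 h
  refine ⟨m, ⟨A', hA0⟩, ?_, ?_⟩
  · rw [ClassGroup.mk0_eq_mk0_iff]
    exact ⟨δ, _, hδ0, hm0, hA'.symm⟩
  · refine mul_left_cancel₀ (pow_ne_zero 2 hδ1) ?_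
    rw [← mul_pow, ← hA', hsq]

/-- Primes not dividing `2 * d` are unramified. -/
lemma sq_dvd_of_dvd {c : ClassGroup B} {m q : ℤi} (h : HasSquare c m) (hq : Prime q)
    (hqd : ¬ q ∣ 2 * d) (hqm : q ∣ m) : q ^ 2 ∣ m := by
  have := H.faithfulSMul
  obtain ⟨A, rfl, hA⟩ := h
  have hcop : IsCoprime q (2 * d) := (hq.irreducible.coprime_iff_not_dvd).2 hqd
  have hndvd2 : ¬ q ∣ 2 := fun h ↦ hqd (h.mul_right _)
  have hndvdd : ¬ q ∣ d := fun h ↦ hqd (h.mul_left _)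
  have hdvd : ∀ a b : ℤi, ∀ w : B,
      algebraMap ℤi B a + algebraMap ℤi B b * s = algebraMap ℤi B q * w → q ∣ a ∧ q ∣ b := by
    intro a b w hw
    obtain ⟨a', b', hab⟩ := H.span w
    have h1 := H.indep (2 * d * a - q * a') (2 * d * b - q * b') (by
      simp only [map_sub, map_mul] at hab ⊢
      linear_combination (algebraMap ℤi B 2 * algebraMap ℤi B d) * hw + (algebraMap ℤi B q) * hab)
    exact ⟨hcop.dvd_of_dvd_mul_left ⟨a', by linear_combination h1.1⟩,
      hcop.dvd_of_dvd_mul_left ⟨b', by linear_combination h1.2⟩⟩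
  have hle : (A : Ideal B) ≤ Ideal.span {algebraMap ℤi B q} := by
    intro x hx
    rw [Ideal.mem_span_singleton]
    obtain ⟨w, hw⟩ : algebraMap ℤi B q ∣ x ^ 2 := by
      have hx2 : x ^ 2 ∈ (A : Ideal B) ^ 2 := Ideal.pow_mem_pow hx 2
      rw [hA, Ideal.mem_span_singleton] at hx2
      exact ((algebraMap ℤi B).map_dvd hqm).trans hx2
    obtain ⟨a, b, hab⟩ := H.span x
    have h2 := hdvd (a ^ 2 + d * b ^ 2) (2 * a * b) (algebraMap ℤi B (2 * d) ^ 2 * w) (by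
      simp only [map_add, map_mul, map_pow, ← H.sq] at hab ⊢
      linear_combination
        (-(algebraMap ℤi B 2 * s ^ 2 * x + algebraMap ℤi B a + algebraMap ℤi B b * s)) * hab
        + (algebraMap ℤi B 2 * s ^ 2) ^ 2 * hw + algebraMap ℤi B a * algebraMap ℤi B b * s *
          (map_ofNat (algebraMap ℤi B) 2))
    have hqa : q ∣ a ∧ q ∣ b := by
      rcases hq.dvd_or_dvd h2.2 with h3 | h3
      · have h4 : q ∣ a := (hq.dvd_or_dvd h3).resolve_left hndvd2
        refine ⟨h4, ?_⟩
        have h5 : q ∣ d * b ^ 2 := (dvd_add_right (dvd_pow h4 two_ne_zero)).1 h2.1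
        exact hq.dvd_of_dvd_pow ((hq.dvd_or_dvd h5).resolve_left hndvdd)
      · refine ⟨?_, h3⟩
        exact hq.dvd_of_dvd_pow ((dvd_add_left ((dvd_pow h3 two_ne_zero).mul_left d)).1 h2.1)
    obtain ⟨⟨a, rfl⟩, ⟨b, rfl⟩⟩ := hqa
    obtain ⟨v, w', hvw⟩ := hcop
    refine ⟨algebraMap ℤi B v * x +
      algebraMap ℤi B w' * (algebraMap ℤi B a + algebraMap ℤi B b * s), ?_⟩
    have hvw' := congrArg (algebraMap ℤi B) hvw
    simp only [map_add, map_mul, map_one] at hvw' hab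
    linear_combination (-x) * hvw' + algebraMap ℤi B w' * hab
  have h3 : Ideal.span {algebraMap ℤi B q} ^ 2 ∣ Ideal.span {algebraMap ℤi B m} := by
    rw [← hA]
    exact pow_dvd_pow_of_dvd (Ideal.dvd_iff_le.2 hle) 2
  rw [Ideal.span_singleton_pow, Ideal.dvd_iff_le, Ideal.span_singleton_le_span_singleton,
    ← map_pow] at h3
  obtain ⟨w, hw⟩ := h3
  obtain ⟨a, b, hab⟩ := H.span w
  have h4 := H.indep (2 * d * m - q ^ 2 * a) (- (q ^ 2 * b)) (by
      simp only [map_sub, map_mul, map_neg, map_pow] at hw hab ⊢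
      linear_combination (algebraMap ℤi B 2 * algebraMap ℤi B d) * hw +
        (algebraMap ℤi B q ^ 2) * hab)
  exact (hcop.pow_left).dvd_of_dvd_mul_left ⟨a, by linear_combination h4.1⟩

/-- A prime exactly dividing `d` ramifies. -/
lemma exists_hasSquare_of_dvd {q d' : ℤi} (hd : d = q * d') (hq : IsCoprime q d') :
    ∃ c : ClassGroup B, HasSquare c q := by
  have := H.faithfulSMul
  have hq0 : q ≠ 0 := by rintro rfl; exact H.ne_zero (by simp [hd])
  have h0 : Ideal.span {algebraMap ℤi B q, s} ∈ nonZeroDivisors (Ideal B) := by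
    refine mem_nonZeroDivisors_of_ne_zero fun h ↦ ?_
    rw [Ideal.zero_eq_bot, Ideal.span_eq_bot] at h
    exact hq0 (by simpa using h (algebraMap ℤi B q) (by simp))
  refine ⟨_, ⟨_, h0⟩, rfl, ?_⟩
  change Ideal.span {algebraMap ℤi B q, s} ^ 2 = _
  have hs := H.sq
  rw [hd, map_mul] at hs
  apply le_antisymm
  · rw [pow_two, Ideal.span_pair_mul_span_pair, Ideal.span_le]
    intro x hx
    simp only [Set.mem_insert_iff, Set.mem_singleton_iff] at hx
    simp only [SetLike.mem_coe, Ideal.mem_span_singleton]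
    rcases hx with rfl | rfl | rfl | rfl
    · simp
    · simp
    · simp
    · rw [← pow_two, hs]; simp
  · rw [Ideal.span_singleton_le_iff_mem]
    obtain ⟨v, w, hvw⟩ := hq
    have hvw' := congrArg (algebraMap ℤi B) hvw
    simp only [map_add, map_mul, map_one] at hvw'
    have : algebraMap ℤi B q =
        algebraMap ℤi B v * algebraMap ℤi B q ^ 2 + algebraMap ℤi B w * s ^ 2 := by
      linear_combination (-algebraMap ℤi B q) * hvw' - algebraMap ℤi B w * hs
    generalize hI : Ideal.span {algebraMap ℤi B q, s} = I
    rw [this, ← hI]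
    exact add_mem (Ideal.mul_mem_left _ _ (Ideal.pow_mem_pow (Ideal.subset_span (by simp)) 2))
      (Ideal.mul_mem_left _ _ (Ideal.pow_mem_pow (Ideal.subset_span (by simp)) 2))

end IsGaussianQuadratic
end ideals

lemma exists_split_prime (p : ℕ) [Fact p.Prime] (hp : p % 4 = 1) :
    ∃ (π : ℤi) (φ : ℤi →+* ZMod p), (∀ x, φ x = 0 ↔ π ∣ x) ∧ π * star π = p ∧ φ (star π) ≠ 0 := by
  have hpp : p.Prime := Fact.out
  obtain ⟨a, b, hab⟩ := Nat.Prime.sq_add_sq (p := p) (by omega)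
  have hndvd : ∀ x y : ℕ, x ^ 2 + y ^ 2 = p → (x : ZMod p) ≠ 0 := by
    intro x y hxy h
    rw [ZMod.natCast_eq_zero_iff] at h
    have hx : x ≠ 0 := by
      rintro rfl
      have : y ^ 2 = p := by simpa using hxy
      exact hpp.prime.not_isSquare ⟨y, by rw [← this, sq]⟩
    have := Nat.le_of_dvd (Nat.pos_of_ne_zero hx) h
    have h2 := hpp.two_le
    nlinarith
  have ha := hndvd a b hab
  have hb := hndvd b a (by omega)
  have hab' : (a : ZMod p) ^ 2 + (b : ZMod p) ^ 2 = 0 := by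
    rw [← Nat.cast_pow, ← Nat.cast_pow, ← Nat.cast_add, hab, ZMod.natCast_self]
  let ι : ZMod p := - a / b
  have hι : ι * ι = ((-1 : ℤ) : ZMod p) := by
    simp only [ι]
    field_simp
    push_cast
    linear_combination hab'
  let φ : ℤi →+* ZMod p := Zsqrtd.lift ⟨ι, hι⟩
  let π : ℤi := ⟨a, b⟩
  have hφπ : φ π = 0 := by
    simp [φ, π, ι, Zsqrtd.lift]
    field_simp
    ring
  have hnorm : π * star π = p := by
    rw [← hab]
    ext <;> simp [π, pow_two]
    ring
  have hsum : π + star π = 2 * a := by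
    ext <;> simp [π]; ring
  have hφs : φ (star π) ≠ 0 := by
    intro h
    have := congrArg φ hsum
    rw [map_add, hφπ, h, map_mul, map_natCast, map_ofNat, zero_add, eq_comm, mul_eq_zero] at this
    rcases this with h2 | h2
    · have h3 : ((2 : ℕ) : ZMod p) = 0 := by exact_mod_cast h2
      rw [ZMod.natCast_eq_zero_iff] at h3
      have := Nat.le_of_dvd two_pos h3
      have := hpp.two_le
      omega
    · exact ha h2
  refine ⟨π, φ, fun x ↦ ⟨fun hx ↦ ?_, ?_⟩, hnorm, hφs⟩
  · obtain ⟨g, hg⟩ := (IsPrincipalIdealRing.principal (RingHom.ker φ)).principal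
    rw [Ideal.submodule_span_eq] at hg
    have hmem : ∀ y, φ y = 0 ↔ g ∣ y := fun y ↦ by
      rw [← RingHom.mem_ker, hg, Ideal.mem_span_singleton]
    obtain ⟨t, ht⟩ := (hmem π).1 hφπ
    have hg1 : ¬ IsUnit g := fun hu ↦ by
      have := (hmem 1).2 hu.dvd
      simp at this
    have hπn : π.norm.natAbs = p := by
      have : (π.norm : ℤi) = (p : ℤ) := by rw [Zsqrtd.norm_eq_mul_conj, hnorm]; rfl
      rw [Int.cast_inj] at this
      rw [this, Int.natAbs_natCast]
    have htu : IsUnit t := by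
      rw [ht, Zsqrtd.norm_mul, Int.natAbs_mul] at hπn
      rw [← Zsqrtd.norm_eq_one_iff] at hg1 ⊢
      exact (Nat.prime_mul_iff.1 (hπn ▸ hpp)).elim (fun h ↦ h.2) (fun h ↦ (hg1 h.2).elim)
    rw [ht, htu.mul_right_dvd]
    exact (hmem x).1 hx
  · rintro ⟨y, rfl⟩
    rw [map_mul, hφπ, zero_mul]

lemma map_star_eq_zero_iff_of_forall {S : Type*} [CommRing S] {π : ℤi} {φ : ℤi →+* S}
    (hφ : ∀ x, φ x = 0 ↔ π ∣ x) (x : ℤi) : φ.comp (starRingEnd ℤi) x = 0 ↔ star π ∣ x := by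
  rw [RingHom.comp_apply, hφ, starRingEnd_apply]
  refine ⟨fun ⟨y, hy⟩ ↦ ⟨star y, ?_⟩, fun ⟨y, hy⟩ ↦ ⟨star y, ?_⟩⟩
  · rw [← star_star x, hy, star_mul']
  · rw [hy, star_mul', star_star]

section local_condition
variable {p : ℕ} [Fact p.Prime] {π : ℤi} {φ : ℤi →+* ZMod p} (hφ : ∀ x, φ x = 0 ↔ π ∣ x)
include hφ

lemma isSquare_of_form {a b c X Y Z : ℤi} (ha : φ a ≠ 0) (hb : φ b ≠ 0) (hc : φ c ≠ 0)
    (hπ : π ≠ 0) (hZ : Z ≠ 0) (h : a * X ^ 2 + π * b * Y ^ 2 = c * Z ^ 2) :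
    quadraticChar (ZMod p) (φ a) * quadraticChar (ZMod p) (φ c) = 1 := by
  have hπ0 : φ π = 0 := (hφ π).2 dvd_rfl
  have hπu : 1 < π.norm.natAbs := by
    have h0 : π.norm ≠ 0 := by simpa [GaussianInt.norm_eq_zero] using hπ
    have h1 : π.norm.natAbs ≠ 1 := by
      rw [Ne, Zsqrtd.norm_eq_one_iff]
      intro hu
      obtain ⟨v, hv⟩ := hu.exists_right_inv
      have := congrArg φ hv
      simp [hπ0] at this
    omega
  induction hn : Z.norm.natAbs using Nat.strong_induction_on generalizing X Y Z with
  | _ n ih =>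
  by_cases hZ0 : φ Z = 0
  · obtain ⟨Z, rfl⟩ := (hφ Z).1 hZ0
    have hX : φ X = 0 := by
      have := congrArg φ h
      simpa [hπ0, ha] using this
    obtain ⟨X, rfl⟩ := (hφ X).1 hX
    have h2 : π * (a * X ^ 2) + b * Y ^ 2 = π * (c * Z ^ 2) :=
      mul_left_cancel₀ hπ (by linear_combination h)
    have hY : φ Y = 0 := by
      have := congrArg φ h2
      simpa [hπ0, hb] using this
    obtain ⟨Y, rfl⟩ := (hφ Y).1 hY
    have hZ' : Z ≠ 0 := right_ne_zero_of_mul hZ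
    refine ih Z.norm.natAbs ?_ hZ' (X := X) (Y := Y) ?_ rfl
    · rw [← hn, Zsqrtd.norm_mul, Int.natAbs_mul]
      have : 0 < Z.norm.natAbs := by
        have h0 : Z.norm ≠ 0 := by simpa [GaussianInt.norm_eq_zero] using hZ'
        omega
      nlinarith
    · exact mul_left_cancel₀ hπ (by linear_combination h2)
  · have h1 := congrArg φ h
    simp only [map_add, map_mul, map_pow, hπ0, zero_mul, add_zero] at h1
    have hX : φ X ≠ 0 := by
      intro hX
      simp [hX, hc, hZ0] at h1
    rw [← map_mul, quadraticChar_one_iff_isSquare (mul_ne_zero ha hc)]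
    refine ⟨φ c * φ Z / φ X, ?_⟩
    field_simp
    linear_combination h1

/-- The condition imposed at a prime exactly dividing `d` by the equation `e (X² - d Y²) = u Z²`. -/
lemma quadraticChar_of_norm_eq (hp : p % 4 = 1) {d d' e e' u X Y Z : ℤi} {a : ℕ} (ha : a ≤ 1)
    (hd : d = π * d') (he : e = π ^ a * e') (hd' : φ d' ≠ 0) (he' : φ e' ≠ 0) (hu : φ u ≠ 0)
    (hπ : π ≠ 0) (hZ : Z ≠ 0) (h : e * (X ^ 2 - d * Y ^ 2) = u * Z ^ 2) :
    quadraticChar (ZMod p) (φ e') * quadraticChar (ZMod p) (φ d') ^ a *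
      quadraticChar (ZMod p) (φ u) = 1 := by
  have hπ0 : φ π = 0 := (hφ π).2 dvd_rfl
  have hneg : quadraticChar (ZMod p) (-1) = 1 := by
    rw [quadraticChar_one_iff_isSquare (by simp), ZMod.exists_sq_eq_neg_one_iff]
    omega
  interval_cases a
  · simp only [pow_zero, one_mul, mul_one] at he ⊢
    subst he hd
    exact isSquare_of_form hφ (b := - e * d') he' (by simp [he', hd']) hu hπ hZ
      (X := X) (Y := Y) (by linear_combination h)
  · simp only [pow_one] at he ⊢
    subst he hd
    have hZ0 : φ Z = 0 := by
      have := congrArg φ h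
      simpa [hπ0, hu] using this.symm
    obtain ⟨Z, rfl⟩ := (hφ Z).1 hZ0
    have h2 : e' * (X ^ 2 - π * d' * Y ^ 2) = π * (u * Z ^ 2) :=
      mul_left_cancel₀ hπ (by linear_combination h)
    have hX0 : φ X = 0 := by
      have := congrArg φ h2
      simpa [hπ0, he'] using this
    obtain ⟨X, rfl⟩ := (hφ X).1 hX0
    have := isSquare_of_form hφ (a := - (e' * d')) (b := e') (c := u) (by simp [he', hd']) he' hu hπ
      (right_ne_zero_of_mul hZ) (X := Y) (Y := X) (mul_left_cancel₀ hπ (by linear_combination h2))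
    rw [map_neg, neg_eq_neg_one_mul, map_mul, hneg, one_mul, map_mul, map_mul] at this
    exact this

end local_condition

lemma quadraticChar_two_of_mod_eight {p : ℕ} [Fact p.Prime] (hp : p % 8 = 5) :
    quadraticChar (ZMod p) 2 = -1 := by
  rw [quadraticChar_neg_one_iff_not_isSquare, ZMod.exists_sq_eq_two_iff (by rintro rfl; simp at hp)]
  omega

lemma quadraticChar_I_of_mod_eight {p : ℕ} [Fact p.Prime] (hp : p % 8 = 5) (φ : ℤi →+* ZMod p) :
    quadraticChar (ZMod p) (φ ⟨0, 1⟩) = -1 := by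
  rw [quadraticChar_neg_one_iff_not_isSquare]
  rintro ⟨y, hy⟩
  have h1 : φ ⟨0, 1⟩ ^ 2 = -1 := by
    rw [← map_pow, show (⟨0, 1⟩ : ℤi) ^ 2 = -1 by ext <;> simp [sq], map_neg, map_one]
  have h4 : y ^ 4 = -1 := by rw [← h1, hy]; ring
  have hy0 : y ≠ 0 := by rintro rfl; simp at h4
  have hf := ZMod.pow_card_sub_one_eq_one hy0
  obtain ⟨k, hk⟩ : ∃ k, p - 1 = 8 * k + 4 := ⟨p / 8, by omega⟩
  rw [hk, pow_add, pow_mul, show y ^ 8 = (y ^ 4) ^ 2 by ring, h4] at hf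
  have : Fact (2 < p) := ⟨by omega⟩
  exact ZMod.neg_one_ne_one (by simpa using hf)

lemma quadraticChar_reciprocity {p q : ℕ} [Fact p.Prime] [Fact q.Prime] (hp : p % 4 = 1)
    (hq : q ≠ 2) : quadraticChar (ZMod p) q = quadraticChar (ZMod q) p := by
  have := legendreSym.quadratic_reciprocity_one_mod_four hp hq
  simpa [legendreSym] using this.symm

lemma sign_system {a b c : ℕ} (ha : a ≤ 1) (hb : b ≤ 1) (hc : c ≤ 1) {A B C D E F g : ℤ}
    (hA : A = 1 ∨ A = -1) (hC : C = 1 ∨ C = -1) (hD : D = 1 ∨ D = -1)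
    (hE : E = 1 ∨ E = -1) (hg : g = 1 ∨ g = -1)
    (k1 : A ^ b * B ^ c * (-1 * A * (B * C)) ^ a * g = 1)
    (k2 : A ^ a * C ^ c * (-1 * A * (B * C)) ^ b * g = 1)
    (k3 : D ^ a * E ^ b * (-1 * F * (B * C)) ^ c * g = 1)
    (k4 : E ^ a * D ^ b * F ^ c * g = 1) (hDE : D * E = B * C) :
    a = 0 ∧ b = 0 ∧ c = 0 ∧ g = 1 := by
  interval_cases a <;> interval_cases b <;> interval_cases c <;>
    simp only [pow_zero, pow_one, one_mul, mul_one] at k1 k2 k3 k4 <;> grind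

theorem norm_eq_trivial {p₁ p₂ : ℕ} [Fact p₁.Prime] [Fact p₂.Prime] (hne : p₁ ≠ p₂)
    (hm₁ : p₁ % 8 = 5) (hm₂ : p₂ % 8 = 5) {π₁ π₂ : ℤi} {φ₁ : ℤi →+* ZMod p₁} {φ₂ : ℤi →+* ZMod p₂}
    (hφ₁ : ∀ x, φ₁ x = 0 ↔ π₁ ∣ x) (hφ₂ : ∀ x, φ₂ x = 0 ↔ π₂ ∣ x)
    (hπ₁ : π₁ * star π₁ = p₁) (hπ₂ : π₂ * star π₂ = p₂)
    (hs₁ : φ₁ (star π₁) ≠ 0) (hs₂ : φ₂ (star π₂) ≠ 0)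
    {a b c : ℕ} (ha : a ≤ 1) (hb : b ≤ 1) (hc : c ≤ 1) {u X Y Z : ℤi} (hu : u = 1 ∨ u = ⟨0, 1⟩)
    (hZ : Z ≠ 0) (h : π₁ ^ a * star π₁ ^ b * π₂ ^ c * (X ^ 2 - ((2 * p₁ * p₂ : ℕ) : ℤi) * Y ^ 2) =
      u * Z ^ 2) :
    a = 0 ∧ b = 0 ∧ c = 0 ∧ u = 1 := by
  have hpp₁ : p₁.Prime := Fact.out
  have hpp₂ : p₂.Prime := Fact.out
  have hp0₁ : ((p₁ : ℕ) : ℤi) ≠ 0 := by exact_mod_cast hpp₁.ne_zero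
  have hp0₂ : ((p₂ : ℕ) : ℤi) ≠ 0 := by exact_mod_cast hpp₂.ne_zero
  have h12 : (p₂ : ZMod p₁) ≠ 0 := by
    rw [Ne, ZMod.natCast_eq_zero_iff, Nat.prime_dvd_prime_iff_eq hpp₁ hpp₂]; exact hne
  have h21 : (p₁ : ZMod p₂) ≠ 0 := by
    rw [Ne, ZMod.natCast_eq_zero_iff, Nat.prime_dvd_prime_iff_eq hpp₂ hpp₁]; exact hne.symm
  have c2₁ := quadraticChar_two_of_mod_eight hm₁
  have c2₂ := quadraticChar_two_of_mod_eight hm₂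
  have n2₁ : (2 : ZMod p₁) ≠ 0 := by
    rintro h; simp [h] at c2₁
  have n2₂ : (2 : ZMod p₂) ≠ 0 := by
    rintro h; simp [h] at c2₂
  have n2₁' : φ₁ 2 ≠ 0 := by rwa [map_ofNat]
  have n2₂' : φ₂ 2 ≠ 0 := by rwa [map_ofNat]
  have hφ₁' := map_star_eq_zero_iff_of_forall hφ₁
  have hφ₂' := map_star_eq_zero_iff_of_forall hφ₂
  have e1 : φ₁ π₂ * φ₁ (star π₂) = p₂ := by rw [← map_mul, hπ₂, map_natCast]
  have e2 : φ₂ π₁ * φ₂ (star π₁) = p₁ := by rw [← map_mul, hπ₁, map_natCast]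
  have n3 : φ₁ π₂ ≠ 0 := fun h ↦ h12 (by rw [← e1, h, zero_mul])
  have n4 : φ₁ (star π₂) ≠ 0 := fun h ↦ h12 (by rw [← e1, h, mul_zero])
  have n5 : φ₂ π₁ ≠ 0 := fun h ↦ h21 (by rw [← e2, h, zero_mul])
  have n6 : φ₂ (star π₁) ≠ 0 := fun h ↦ h21 (by rw [← e2, h, mul_zero])
  have f1 := congrArg (quadraticChar (ZMod p₁)) e1
  have f2 := congrArg (quadraticChar (ZMod p₂)) e2
  rw [map_mul] at f1 f2
  have hu₁ : φ₁ u ≠ 0 := by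
    intro hu0
    have := quadraticChar_I_of_mod_eight hm₁ φ₁
    rcases hu with rfl | rfl
    · simp at hu0
    · simp [hu0] at this
  have hu₂ : φ₂ u ≠ 0 := by
    intro hu0
    have := quadraticChar_I_of_mod_eight hm₂ φ₂
    rcases hu with rfl | rfl
    · simp at hu0
    · simp [hu0] at this
  have hu₁' : φ₁ (star u) ≠ 0 := by
    intro hu0
    have := quadraticChar_I_of_mod_eight hm₁ (φ₁.comp (starRingEnd ℤi))
    rcases hu with rfl | rfl
    · simp at hu0
    · simp only [RingHom.comp_apply, starRingEnd_apply, hu0] at this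
      simp at this
  have hu₂' : φ₂ (star u) ≠ 0 := by
    intro hu0
    have := quadraticChar_I_of_mod_eight hm₂ (φ₂.comp (starRingEnd ℤi))
    rcases hu with rfl | rfl
    · simp at hu0
    · simp only [RingHom.comp_apply, starRingEnd_apply, hu0] at this
      simp at this
  have k1 := quadraticChar_of_norm_eq hφ₁ (by omega) (d := ((2 * p₁ * p₂ : ℕ) : ℤi))
    (d' := 2 * star π₁ * p₂) (e' := star π₁ ^ b * π₂ ^ c) (a := a) ha
    (by push_cast; rw [← hπ₁]; ring) (by ring) (by simp [n2₁', h12, hs₁]) (by simp [hs₁, n3]) hu₁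
    (left_ne_zero_of_mul (hπ₁ ▸ hp0₁)) hZ h
  have k2 := quadraticChar_of_norm_eq hφ₁' (by omega) (d := ((2 * p₁ * p₂ : ℕ) : ℤi))
    (d' := 2 * π₁ * p₂) (e' := π₁ ^ a * π₂ ^ c) (a := b) hb
    (by push_cast; rw [← hπ₁]; ring) (by ring)
    (by simp [n2₁', h12, hs₁, RingHom.comp_apply, starRingEnd_apply, star_ofNat])
    (by simp [hs₁, n4, RingHom.comp_apply, starRingEnd_apply])
    (by simpa [starRingEnd_apply] using hu₁')
    (right_ne_zero_of_mul (hπ₁ ▸ hp0₁)) hZ h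
  have k3 := quadraticChar_of_norm_eq hφ₂ (by omega) (d := ((2 * p₁ * p₂ : ℕ) : ℤi))
    (d' := 2 * star π₂ * p₁) (e' := π₁ ^ a * star π₁ ^ b) (a := c) hc
    (by push_cast; rw [← hπ₂]; ring) (by ring) (by simp [n2₂', h21, hs₂]) (by simp [n5, n6]) hu₂
    (left_ne_zero_of_mul (hπ₂ ▸ hp0₂)) hZ h
  have k4 := quadraticChar_of_norm_eq hφ₂' (by omega) (d := ((2 * p₁ * p₂ : ℕ) : ℤi))
    (d' := 2 * π₂ * p₁) (e' := π₁ ^ a * star π₁ ^ b * π₂ ^ c) (a := 0) zero_le_one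
    (by push_cast; rw [← hπ₂]; ring) (by ring)
    (by simp [n2₂', h21, hs₂, RingHom.comp_apply, starRingEnd_apply, star_ofNat])
    (by simp [n5, n6, hs₂, RingHom.comp_apply, starRingEnd_apply, star_star])
    (by simpa [starRingEnd_apply] using hu₂')
    (right_ne_zero_of_mul (hπ₂ ▸ hp0₂)) hZ h
  have f3 := quadraticChar_reciprocity (p := p₁) (q := p₂) (by omega) (by rintro rfl; simp at hm₂)
  have cu : ∃ g : ℤ, (g = 1 ∧ u = 1 ∨ g = -1) ∧ quadraticChar (ZMod p₁) (φ₁ u) = g ∧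
      quadraticChar (ZMod p₁) (φ₁ (star u)) = g ∧ quadraticChar (ZMod p₂) (φ₂ u) = g ∧
      quadraticChar (ZMod p₂) (φ₂ (star u)) = g := by
    rcases hu with rfl | rfl
    · exact ⟨1, by simp⟩
    · exact ⟨-1, Or.inr rfl, quadraticChar_I_of_mod_eight hm₁ φ₁,
        quadraticChar_I_of_mod_eight hm₁ (φ₁.comp (starRingEnd ℤi)),
        quadraticChar_I_of_mod_eight hm₂ φ₂,
        quadraticChar_I_of_mod_eight hm₂ (φ₂.comp (starRingEnd ℤi))⟩
  obtain ⟨g, hg, g1, g2, g3, g4⟩ := cu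
  simp only [map_mul, map_pow, RingHom.comp_apply, starRingEnd_apply, star_star, map_natCast,
    map_ofNat, c2₁, c2₂, f3, g1, g2, g3, g4, pow_zero, mul_one]
    at k1 k2 k3 k4 f1 f2
  have hA := quadraticChar_dichotomy hs₁
  have hC := quadraticChar_dichotomy n4
  have hD := quadraticChar_dichotomy n5
  have hE := quadraticChar_dichotomy n6
  generalize quadraticChar (ZMod p₁) (φ₁ (star π₁)) = A at *
  generalize quadraticChar (ZMod p₁) (φ₁ π₂) = B at *
  generalize quadraticChar (ZMod p₁) (φ₁ (star π₂)) = C at *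
  generalize quadraticChar (ZMod p₂) (φ₂ π₁) = D at *
  generalize quadraticChar (ZMod p₂) (φ₂ (star π₁)) = E at *
  generalize quadraticChar (ZMod p₂) (φ₂ (star π₂)) = F at *
  generalize quadraticChar (ZMod p₂) p₁ = ρ at *
  clear * - ha hb hc hg k1 k2 k3 k4 f1 f2 hA hC hD hE
  subst f1
  have key : a = 0 ∧ b = 0 ∧ c = 0 ∧ g = 1 := by
    have hg' : g = 1 ∨ g = -1 := hg.imp_left And.left
    clear hg
    exact sign_system ha hb hc hA hC hD hE hg' k1 k2 k3 k4 f2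
  refine ⟨key.1, key.2.1, key.2.2.1, ?_⟩
  rcases hg with hg | hg
  · exact hg.2
  · simp [key.2.2.2] at hg

lemma Nat.Coprime.eq_prime_mul_of_mul_eq {q k m t : ℕ} (hq : q.Prime) (hkm : k.Coprime m)
    (h : k * m = q * t) :
    (∃ k', k = q * k' ∧ k'.Coprime m ∧ k' * m = t) ∨
      ∃ m', m = q * m' ∧ k.Coprime m' ∧ k * m' = t := by
  rcases (hq.dvd_mul).1 (Dvd.intro _ h.symm) with ⟨k, rfl⟩ | ⟨m, rfl⟩
  · exact Or.inl ⟨k, rfl, hkm.coprime_mul_left,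
      Nat.eq_of_mul_eq_mul_left hq.pos (by rw [← h]; ring)⟩
  · exact Or.inr ⟨m, rfl, hkm.coprime_mul_left_right,
      Nat.eq_of_mul_eq_mul_left hq.pos (by rw [← h]; ring)⟩

lemma Nat.Coprime.eq_sq_of_mul_eq_sq {k m z : ℕ} (hkm : k.Coprime m) (h : k * m = z ^ 2) :
    ∃ r s, k = r ^ 2 ∧ m = s ^ 2 := by
  obtain ⟨r, hr⟩ := exists_eq_pow_of_mul_eq_pow (Nat.isUnit_iff.2 hkm) h
  obtain ⟨s, hs⟩ := exists_eq_pow_of_mul_eq_pow (Nat.isUnit_iff.2 hkm.symm) ((mul_comm _ _).trans h)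
  exact ⟨r, s, hr, hs⟩

lemma quadraticChar_eq_one_of_mul_sq {p : ℕ} [Fact p.Prime] (hp : p % 8 = 5) {α v : ZMod p}
    (h : α * v ^ 2 = 1 ∨ α * v ^ 2 + 1 = 0) : quadraticChar (ZMod p) α = 1 := by
  have hp2 : Fact (2 < p) := ⟨by omega⟩
  have hneg : quadraticChar (ZMod p) (-1) = 1 := by
    rw [quadraticChar_one_iff_isSquare (by simp), ZMod.exists_sq_eq_neg_one_iff]
    omega
  have hv : v ≠ 0 := by rintro rfl; simp at h
  have h2 : quadraticChar (ZMod p) (α * v ^ 2) = 1 := by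
    rcases h with h | h
    · rw [h, map_one]
    · rw [eq_neg_of_add_eq_zero_left h, hneg]
  rwa [map_mul, quadraticChar_sq_one' hv, mul_one] at h2

theorem exists_negative_pell {p q : ℕ} [Fact p.Prime] [Fact q.Prime] (hne : p ≠ q)
    (hp : p % 8 = 5) (hq : q % 8 = 5) :
    ∃ T U : ℤ, T ^ 2 + 1 = ((2 * p * q : ℕ) : ℤ) * U ^ 2 := by
  have hpp : p.Prime := Fact.out
  have hqp : q.Prime := Fact.out
  have c2p := quadraticChar_two_of_mod_eight hp
  have c2q := quadraticChar_two_of_mod_eight hq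
  have hrec := quadraticChar_reciprocity (p := p) (q := q) (by omega) (by rintro rfl; simp at hq)
  have hd0 : (0 : ℤ) < ((2 * p * q : ℕ) : ℤ) := by
    have := hpp.pos; have := hqp.pos; positivity
  have hd16 : (2 * p * q) % 4 = 2 := by
    have : (p * q) % 2 = 1 := by
      rw [Nat.mul_mod]
      simp [show p % 2 = 1 by omega, show q % 2 = 1 by omega]
    rw [mul_assoc]; omega
  have hns : ¬ IsSquare ((2 * p * q : ℕ) : ℤ) := by
    rw [Int.isSquare_natCast_iff]
    rintro ⟨r, hr⟩
    rw [hr] at hd16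
    have : r % 4 < 4 := Nat.mod_lt _ (by norm_num)
    rw [Nat.mul_mod] at hd16
    interval_cases r % 4 <;> simp at hd16
  obtain ⟨a, ha1, ha2, hmin⟩ := Pell.IsFundamental.exists_of_not_isSquare hd0 hns
  have hprop := a.prop
  obtain ⟨x, hx⟩ := Int.eq_ofNat_of_zero_le (by omega : 0 ≤ a.x)
  obtain ⟨y, hy⟩ := Int.eq_ofNat_of_zero_le (by omega : 0 ≤ a.y)
  rw [hx] at ha1
  rw [hx, hy] at hprop
  have hxy : x ^ 2 = 2 * p * q * y ^ 2 + 1 := by zify; push_cast at hprop; linear_combination hprop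
  obtain ⟨e, he⟩ : ∃ e, 2 * p * q = 4 * e + 2 := ⟨2 * p * q / 4, by omega⟩
  have hxodd : x % 2 = 1 := by
    rcases Nat.mod_two_eq_zero_or_one x with h | h
    · obtain ⟨w, rfl⟩ := Nat.dvd_of_mod_eq_zero h
      rw [he] at hxy
      ring_nf at hxy
      omega
    · exact h
  obtain ⟨k, rfl⟩ : ∃ k, x = 2 * k + 1 := ⟨x / 2, by omega⟩
  have hyeven : y % 2 = 0 := by
    rcases Nat.mod_two_eq_zero_or_one y with h | h
    · exact h
    · obtain ⟨w, rfl⟩ : ∃ w, y = 2 * w + 1 := ⟨y / 2, by omega⟩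
      rw [he] at hxy
      ring_nf at hxy
      omega
  obtain ⟨z, rfl⟩ := Nat.dvd_of_mod_eq_zero hyeven
  have hk : k * (k + 1) = 2 * (p * (q * z ^ 2)) := by nlinarith
  have hcop : k.Coprime (k + 1) := by simp
  have hk0 : 0 < k := by push_cast at ha1; omega
  clear hprop hxy hyeven hy
  generalize hm : k + 1 = m at hk hcop
  have toP : ∀ {u v : ℕ}, u + 1 = v → (u : ZMod p) + 1 = v := by rintro u _ rfl; simp
  have toQ : ∀ {u v : ℕ}, u + 1 = v → (u : ZMod q) + 1 = v := by rintro u _ rfl; simp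
  rcases hcop.eq_prime_mul_of_mul_eq Nat.prime_two hk with
    ⟨k, rfl, hcop, hk⟩ | ⟨m, rfl, hcop, hk⟩ <;>
  rcases hcop.eq_prime_mul_of_mul_eq hpp hk with ⟨k, rfl, hcop, hk⟩ | ⟨m, rfl, hcop, hk⟩ <;>
  rcases hcop.eq_prime_mul_of_mul_eq hqp hk with ⟨k, rfl, hcop, hk⟩ | ⟨m, rfl, hcop, hk⟩ <;>
  obtain ⟨r, s, rfl, rfl⟩ := hcop.eq_sq_of_mul_eq_sq hk <;>
  have hP := toP hm <;> have hQ := toQ hm <;> push_cast at hP hQ <;>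
  simp only [CharP.cast_eq_zero, zero_mul, mul_zero, zero_add] at hP hQ
  · have hlt : 1 < s := by nlinarith
    let b : Pell.Solution₁ ((2 * p * q : ℕ) : ℤ) := Pell.Solution₁.mk s r (by
      zify at hm; push_cast; linear_combination -hm)
    have hb := hmin (b := b) (by simpa [b] using hlt)
    rw [hx] at hb
    simp only [b, Pell.Solution₁.x_mk] at hb
    have hb' : 2 * (2 * (p * (q * r ^ 2))) + 1 ≤ s := by exact_mod_cast hb
    nlinarith
  · have h1 := quadraticChar_eq_one_of_mul_sq hp (Or.inl hP.symm)
    have h2 := quadraticChar_eq_one_of_mul_sq (α := 2 * (p : ZMod q)) (v := r) hq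
      (Or.inr (by rw [← hQ]; ring))
    rw [map_mul, c2q, ← hrec, h1] at h2
    simp at h2
  · have h1 := quadraticChar_eq_one_of_mul_sq hq (Or.inl hQ.symm)
    have h2 := quadraticChar_eq_one_of_mul_sq (α := 2 * (q : ZMod p)) (v := r) hp
      (Or.inr (by rw [← hP]; ring))
    rw [map_mul, c2p, hrec, h1] at h2
    simp at h2
  · rw [quadraticChar_eq_one_of_mul_sq hp (Or.inr hP)] at c2p
    simp at c2p
  · rw [quadraticChar_eq_one_of_mul_sq hp (Or.inl hP.symm)] at c2p
    simp at c2p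
  · have h1 := quadraticChar_eq_one_of_mul_sq hq (Or.inr hQ)
    have h2 := quadraticChar_eq_one_of_mul_sq (α := 2 * (q : ZMod p)) (v := s) hp
      (Or.inl (by rw [hP]; ring))
    rw [map_mul, c2p, hrec, h1] at h2
    simp at h2
  · have h1 := quadraticChar_eq_one_of_mul_sq hp (Or.inr hP)
    have h2 := quadraticChar_eq_one_of_mul_sq (α := 2 * (p : ZMod q)) (v := s) hq
      (Or.inl (by rw [hQ]; ring))
    rw [map_mul, c2q, ← hrec, h1] at h2
    simp at h2
  · exact ⟨r, s, by zify at hm; push_cast; linear_combination hm⟩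

lemma exists_addEquiv_of_basis {G : Type*} [CommGroup G] [Finite G] {c₁ c₂ c₃ : G}
    (h₁ : c₁ ^ 2 = 1) (h₂ : c₂ ^ 2 = 1) (h₃ : c₃ ^ 2 = 1)
    (h4 : ∀ c : G, (c ^ 2) ^ 2 = 1 → c ^ 2 = 1)
    (hspan : ∀ c : G, c ^ 2 = 1 → ∃ a b e : ℕ, c = c₁ ^ a * c₂ ^ b * c₃ ^ e)
    (hindep : ∀ a b e : ℕ, a ≤ 1 → b ≤ 1 → e ≤ 1 → c₁ ^ a * c₂ ^ b * c₃ ^ e = 1 →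
      a = 0 ∧ b = 0 ∧ e = 0) (P : Sylow 2 G) :
    Nonempty (Additive P ≃+ (ZMod 2 × ZMod 2 × ZMod 2)) := by
  have hmem : ∀ c : G, c ^ 2 = 1 → c ∈ P := by
    intro c hc
    have hp : IsPGroup 2 (Subgroup.zpowers c) := by
      rintro ⟨x, hx⟩
      obtain ⟨k, rfl⟩ := Subgroup.mem_zpowers_iff.1 hx
      refine ⟨1, Subtype.ext ?_⟩
      simp only [pow_one, SubmonoidClass.mk_pow, OneMemClass.coe_one]
      rw [← zpow_natCast, zpow_comm, zpow_natCast, hc, one_zpow]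
    obtain ⟨Q, hQ⟩ := hp.exists_le_sylow
    have := Sylow.unique_of_normal P inferInstance
    rw [Subsingleton.elim P Q]
    exact hQ (Subgroup.mem_zpowers c)
  have hsq : ∀ c : G, c ∈ P → c ^ 2 = 1 := by
    intro c hc
    obtain ⟨k, hk⟩ := P.isPGroup' ⟨c, hc⟩
    replace hk : c ^ 2 ^ k = 1 := by simpa using congrArg Subtype.val hk
    induction k with
    | zero => simp at hk; simp [hk]
    | succ k ih =>
      cases k with
      | zero => simpa using hk
      | succ k => exact ih (by
          rw [pow_succ, pow_mul]
          refine h4 _ ?_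
          rwa [pow_succ, pow_succ, pow_mul, pow_mul] at hk)
  let g (c : P) (hc : c ^ 2 = 1) : ZMod 2 →+ Additive P :=
    ZMod.lift 2 ⟨zmultiplesHom (Additive P) (Additive.ofMul c), by
      simpa [ofNat_zsmul] using congrArg Additive.ofMul hc⟩
  have hg : ∀ c hc (n : ℕ), g c hc n = Additive.ofMul (c ^ n) := by
    intro c hc n
    simpa [g] using ZMod.lift_coe 2 ⟨zmultiplesHom (Additive P) (Additive.ofMul c), by
      simpa [ofNat_zsmul] using congrArg Additive.ofMul hc⟩ n
  let f : ZMod 2 × ZMod 2 × ZMod 2 →+ Additive P :=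
    (g ⟨c₁, hmem _ h₁⟩ (Subtype.ext h₁)).coprod
      ((g ⟨c₂, hmem _ h₂⟩ (Subtype.ext h₂)).coprod (g ⟨c₃, hmem _ h₃⟩ (Subtype.ext h₃)))
  have hf : ∀ a b e : ℕ, ((f (a, b, e)).toMul : G) = c₁ ^ a * c₂ ^ b * c₃ ^ e := by
    intro a b e
    simp [f, hg, mul_assoc]
  refine ⟨(AddEquiv.ofBijective f ⟨(injective_iff_map_eq_zero f).2 ?_, ?_⟩).symm⟩
  · rintro ⟨x, y, z⟩ h
    have h' := hf x.val y.val z.val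
    simp only [ZMod.natCast_zmod_val, h] at h'
    have hlt (x : ZMod 2) : x.val ≤ 1 := Nat.le_of_lt_succ x.val_lt
    have h0 := hindep _ _ _ (hlt x) (hlt y) (hlt z) h'.symm
    simpa [ZMod.val_eq_zero] using h0
  · intro p
    obtain ⟨a, b, e, h⟩ := hspan _ (hsq _ p.toMul.2)
    exact ⟨(a, b, e), congrArg Additive.ofMul (Subtype.ext ((hf a b e).trans h.symm))⟩

lemma prime_of_forall_map_eq_zero_iff {R S : Type*} [CommRing R] [CommRing S] [IsDomain S]
    {π : R} {φ : R →+* S} (hφ : ∀ x, φ x = 0 ↔ π ∣ x) (hπ : π ≠ 0) : Prime π := by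
  refine ⟨hπ, fun hu ↦ ?_, fun a b h ↦ ?_⟩
  · have := (hφ 1).2 hu.dvd
    simp at this
  · rwa [← hφ, ← hφ, ← mul_eq_zero, ← map_mul, hφ]

lemma gaussianInt_prime_one_add_I : Prime (⟨1, 1⟩ : ℤi) := by
  rw [← irreducible_iff_prime]
  refine ⟨?_, fun {a b} h ↦ ?_⟩
  · rw [← Zsqrtd.norm_eq_one_iff]
    simp [Zsqrtd.norm_def]
  · have h2 := congrArg (fun x ↦ (Zsqrtd.norm x).natAbs) h
    simp only [Zsqrtd.norm_mul, Int.natAbs_mul] at h2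
    rw [← Zsqrtd.norm_eq_one_iff, ← Zsqrtd.norm_eq_one_iff]
    have hp : ((Zsqrtd.norm a).natAbs * (Zsqrtd.norm b).natAbs).Prime := by
      rw [← h2]
      norm_num [Zsqrtd.norm_def]
    exact (Nat.prime_mul_iff.1 hp).elim (fun h ↦ Or.inr h.2) (fun h ↦ Or.inl h.2)

section genus

variable {B : Type*} [CommRing B] [IsDedekindDomain B] [Algebra ℤi B]

/-- Away from a prime `l`, the classes containing a square root of a Gaussian integer are generated
by the ramified primes. -/
lemma IsGaussianQuadratic.mem_of_hasSquare {d : ℤi} {s : B} (H : IsGaussianQuadratic B d s)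
    {G : Subgroup (ClassGroup B)} {l : ℤi}
    (hG : ∀ q, Prime q → q ∣ 2 * d → ¬ Associated q l → ∃ c ∈ G, HasSquare c q)
    {c : ClassGroup B} {m : ℤi} (h : HasSquare c m) (hm : ¬ l ∣ m) : c ∈ G := by
  have := H.faithfulSMul
  refine wellFounded_dvdNotUnit.induction
    (C := fun m ↦ ∀ {c}, HasSquare c m → ¬ l ∣ m → c ∈ G) m (fun m ih c h hm ↦ ?_) h hm
  have hm0 := h.ne_zero
  by_cases hu : IsUnit m
  · have h1 := h.of_associated (associated_one_iff_isUnit.2 hu)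
    rw [h1.unique HasSquare.one]
    exact one_mem G
  obtain ⟨q, hq, r, rfl⟩ := WfDvdMonoid.exists_irreducible_factor hu hm0
  replace hq := hq.prime
  have hr0 : r ≠ 0 := right_ne_zero_of_mul hm0
  have hlr : ¬ l ∣ r := fun h ↦ hm (h.mul_left q)
  by_cases hqd : q ∣ 2 * d
  · obtain ⟨c', hc', hcq⟩ := hG q hq hqd fun ha ↦ hm (ha.symm.dvd.mul_right r)
    have h2 : HasSquare (c' * c) r := HasSquare.of_sq_mul (r := q) (by
      simpa only [pow_two, mul_assoc] using hcq.mul h)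
    exact (G.mul_mem_cancel_left hc').1 (ih r ⟨hr0, q, hq.not_isUnit, mul_comm _ _⟩ h2 hlr)
  · obtain ⟨t, ht⟩ := H.sq_dvd_of_dvd h hq hqd (dvd_mul_right q r)
    rw [ht] at h hm hm0
    rw [ht] at ih
    exact ih t ⟨right_ne_zero_of_mul hm0, q ^ 2,
      fun hu ↦ hq.not_isUnit ((isUnit_pow_iff two_ne_zero).1 hu),
      mul_comm _ _⟩ h.of_sq_mul fun h ↦ hm (h.mul_left _)

lemma HasSquare.pow {c : ClassGroup B} {m : ℤi} (h : HasSquare c m) (n : ℕ) :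
    HasSquare (c ^ n) (m ^ n) := by
  induction n with
  | zero => simpa using HasSquare.one
  | succ n ih => simpa only [pow_succ] using ih.mul h

lemma HasSquare.of_two_mul [FaithfulSMul ℤi B] {c : ClassGroup B} {m : ℤi}
    (h : HasSquare c (2 * m)) : HasSquare c m := by
  refine HasSquare.of_sq_mul (r := ⟨1, 1⟩) (h.of_associated ?_)
  refine (Associated.mul_right ?_ m)
  exact ⟨⟨⟨0, 1⟩, ⟨0, -1⟩, by ext <;> simp, by ext <;> simp⟩, by ext <;> simp [pow_two]⟩

theorem IsGaussianQuadratic.exists_addEquiv_sylow {p₁ p₂ : ℕ} [Fact p₁.Prime] [Fact p₂.Prime]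
    (hne : p₁ ≠ p₂) (hm₁ : p₁ % 8 = 5) (hm₂ : p₂ % 8 = 5) {s : B}
    (H : IsGaussianQuadratic B ((2 * p₁ * p₂ : ℕ) : ℤi) s) [Finite (ClassGroup B)]
    (P : Sylow 2 (ClassGroup B)) :
    Nonempty (Additive P ≃+ (ZMod 2 × ZMod 2 × ZMod 2)) := by
  have := H.faithfulSMul
  have hpp₁ : p₁.Prime := Fact.out
  have hpp₂ : p₂.Prime := Fact.out
  have hp0₁ : ((p₁ : ℕ) : ℤi) ≠ 0 := by exact_mod_cast hpp₁.ne_zero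
  have hp0₂ : ((p₂ : ℕ) : ℤi) ≠ 0 := by exact_mod_cast hpp₂.ne_zero
  have h12 : (p₂ : ZMod p₁) ≠ 0 := by
    rw [Ne, ZMod.natCast_eq_zero_iff, Nat.prime_dvd_prime_iff_eq hpp₁ hpp₂]; exact hne
  have h21 : (p₁ : ZMod p₂) ≠ 0 := by
    rw [Ne, ZMod.natCast_eq_zero_iff, Nat.prime_dvd_prime_iff_eq hpp₂ hpp₁]; exact hne.symm
  obtain ⟨π₁, φ₁, hφ₁, hπ₁, hs₁⟩ := exists_split_prime p₁ (by omega)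
  obtain ⟨π₂, φ₂, hφ₂, hπ₂, hs₂⟩ := exists_split_prime p₂ (by omega)
  have hφ₁' := map_star_eq_zero_iff_of_forall hφ₁
  have hφ₂' := map_star_eq_zero_iff_of_forall hφ₂
  have n2₁ : φ₁ 2 ≠ 0 := by
    intro h
    have := quadraticChar_two_of_mod_eight hm₁
    rw [map_ofNat] at h
    simp [h] at this
  have n2₂ : φ₂ 2 ≠ 0 := by
    intro h
    have := quadraticChar_two_of_mod_eight hm₂
    rw [map_ofNat] at h
    simp [h] at this
  have q₁ := prime_of_forall_map_eq_zero_iff hφ₁ (left_ne_zero_of_mul (hπ₁ ▸ hp0₁))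
  have q₂ := prime_of_forall_map_eq_zero_iff hφ₂ (left_ne_zero_of_mul (hπ₂ ▸ hp0₂))
  have q₁' := prime_of_forall_map_eq_zero_iff hφ₁' (right_ne_zero_of_mul (hπ₁ ▸ hp0₁))
  have q₂' := prime_of_forall_map_eq_zero_iff hφ₂' (right_ne_zero_of_mul (hπ₂ ▸ hp0₂))
  obtain ⟨c₁, h₁⟩ := H.exists_hasSquare_of_dvd (q := π₁) (d' := 2 * star π₁ * p₂)
    (by push_cast; rw [← hπ₁]; ring)
    (q₁.irreducible.coprime_iff_not_dvd.2 (by rw [← hφ₁]; simp [n2₁, h12, hs₁]))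
  obtain ⟨c₂, h₂⟩ := H.exists_hasSquare_of_dvd (q := star π₁) (d' := 2 * π₁ * p₂)
    (by push_cast; rw [← hπ₁]; ring)
    (q₁'.irreducible.coprime_iff_not_dvd.2 (by
      rw [← hφ₁']; simp [n2₁, h12, hs₁, starRingEnd_apply, star_ofNat]))
  obtain ⟨c₃, h₃⟩ := H.exists_hasSquare_of_dvd (q := π₂) (d' := 2 * star π₂ * p₁)
    (by push_cast; rw [← hπ₂]; ring)
    (q₂.irreducible.coprime_iff_not_dvd.2 (by rw [← hφ₂]; simp [n2₂, h21, hs₂]))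
  have hcomb (a b e : ℕ) :
      HasSquare (c₁ ^ a * c₂ ^ b * c₃ ^ e) (π₁ ^ a * star π₁ ^ b * π₂ ^ e) :=
    ((h₁.pow a).mul (h₂.pow b)).mul (h₃.pow e)
  have htriv {c : ClassGroup B} {a b e : ℕ} (ha : a ≤ 1) (hb : b ≤ 1) (he : e ≤ 1)
      (h : HasSquare (c ^ 2) (π₁ ^ a * star π₁ ^ b * π₂ ^ e)) : a = 0 ∧ b = 0 ∧ e = 0 := by
    obtain ⟨X, Y, Z, u, hu, hZ, heq⟩ := H.exists_norm_eq h
    obtain ⟨w, hw, rfl | rfl⟩ := gaussianInt_unit hu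
    · have := norm_eq_trivial hne hm₁ hm₂ hφ₁ hφ₂ hπ₁ hπ₂ hs₁ hs₂ ha hb he (Or.inl rfl)
        (mul_ne_zero hw.ne_zero hZ) (heq.trans (by ring))
      exact ⟨this.1, this.2.1, this.2.2.1⟩
    · have := norm_eq_trivial hne hm₁ hm₂ hφ₁ hφ₂ hπ₁ hπ₂ hs₁ hs₂ ha hb he (Or.inr rfl)
        (mul_ne_zero hw.ne_zero hZ) (heq.trans (by ring))
      exact ⟨this.1, this.2.1, this.2.2.1⟩
  have hd : HasSquare (1 : ClassGroup B) ((2 * p₁ * p₂ : ℕ) : ℤi) := by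
    refine HasSquare.of_isPrincipal (β := s) ?_ (by rw [H.sq])
    rintro rfl
    have := H.indep 0 1 (by simp)
    simp at this
  have h₄ : HasSquare (c₁ * c₂ * c₃) (star π₂) := by
    have h : HasSquare (1 : ClassGroup B) (p₁ * p₂) :=
      HasSquare.of_two_mul (by simpa [mul_assoc] using hd)
    have h' := ((h₁.mul h₂).mul h₃).mul h
    rw [mul_one] at h'
    refine HasSquare.of_sq_mul (r := π₁ * star π₁ * π₂) ?_
    convert h' using 1
    rw [← hπ₁, ← hπ₂]
    ring
  obtain ⟨m', hm', h₅⟩ : ∃ m' : ℤi, ¬ ⟨1, 1⟩ ∣ m' ∧ HasSquare (1 : ClassGroup B) (⟨1, 1⟩ * m') := by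
    obtain ⟨T, U, hTU⟩ := exists_negative_pell hne hm₁ hm₂
    obtain ⟨t, rfl⟩ : Odd T := by
      rw [← Int.not_even_iff_odd]
      intro hT
      have : ¬ Even (T ^ 2 + 1) := by
        rw [Int.not_even_iff_odd]
        exact (hT.pow_of_ne_zero two_ne_zero).add_one
      exact this (by rw [hTU]; push_cast; simp [mul_assoc])
    refine ⟨⟨t + 1, -t⟩, ?_, ?_⟩
    · rintro ⟨r, hr⟩
      have := congrArg Zsqrtd.norm hr
      rw [Zsqrtd.norm_mul] at this
      simp only [Zsqrtd.norm_def] at this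
      ring_nf at this
      omega
    · refine HasSquare.of_two_mul (HasSquare.of_isPrincipal
        (β := algebraMap ℤi B ⟨2 * t + 1, 1⟩ + algebraMap ℤi B U * s) ?_ ?_)
      · intro h
        have := (H.indep _ _ h).1
        simp [Zsqrtd.ext_iff] at this
      · have hTU' : ((2 * t + 1 : ℤ) : ℤi) ^ 2 + 1 = ((2 * p₁ * p₂ : ℕ) : ℤi) * (U : ℤi) ^ 2 := by
          exact_mod_cast congrArg (Int.cast (R := ℤi)) hTU
        have hi : (⟨2 * t + 1, 1⟩ : ℤi) ^ 2 = 2 * ((2 * t + 1 : ℤ) : ℤi) * ⟨2 * t + 1, 1⟩ -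
            (((2 * t + 1 : ℤ) : ℤi) ^ 2 + 1) := by
          ext <;> simp [pow_two] <;> ring
        have hi' : (⟨1, 1⟩ * ⟨t + 1, -t⟩ : ℤi) = ⟨2 * t + 1, 1⟩ := by ext <;> simp; ring
        rw [hi']
        generalize (⟨2 * t + 1, 1⟩ : ℤi) = τ at *
        generalize ((2 * t + 1 : ℤ) : ℤi) = T at *
        have e1 := congrArg (algebraMap ℤi B) hTU'
        have e2 := congrArg (algebraMap ℤi B) hi
        have e3 := H.sq
        simp only [map_add, map_sub, map_mul, map_pow, map_one, map_ofNat] at e1 e2 ⊢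
        refine Associated.symm ⟨⟨algebraMap ℤi B T + algebraMap ℤi B U * s,
          algebraMap ℤi B U * s - algebraMap ℤi B T, ?_, ?_⟩, ?_⟩
        · linear_combination algebraMap ℤi B U ^ 2 * e3 - e1
        · linear_combination algebraMap ℤi B U ^ 2 * e3 - e1
        · simp only
          linear_combination -e2 + e1 - algebraMap ℤi B U ^ 2 * e3
  have hspan (c : ClassGroup B) (hc : c ^ 2 = 1) :
      ∃ a b e : ℕ, a ≤ 1 ∧ b ≤ 1 ∧ e ≤ 1 ∧ c = c₁ ^ a * c₂ ^ b * c₃ ^ e := by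
    have hG : ∀ q, Prime q → q ∣ 2 * ((2 * p₁ * p₂ : ℕ) : ℤi) → ¬ Associated q ⟨1, 1⟩ →
        ∃ c ∈ Subgroup.closure {c₁, c₂, c₃}, HasSquare c q := by
      intro q hq hqd hql
      have m₁ : c₁ ∈ Subgroup.closure {c₁, c₂, c₃} := Subgroup.subset_closure (by simp)
      have m₂ : c₂ ∈ Subgroup.closure {c₁, c₂, c₃} := Subgroup.subset_closure (by simp)
      have m₃ : c₃ ∈ Subgroup.closure {c₁, c₂, c₃} := Subgroup.subset_closure (by simp)
      have hl4 : (⟨1, 1⟩ : ℤi) ^ 4 = -4 := by decide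
      have h2d : 2 * ((2 * p₁ * p₂ : ℕ) : ℤi) =
          ⟨1, 1⟩ ^ 4 * -(π₁ * star π₁ * (π₂ * star π₂)) := by
        rw [hl4, hπ₁, hπ₂]
        push_cast
        ring
      rw [h2d] at hqd
      have hassoc {r : ℤi} (hr : Prime r) (h : q ∣ r) : Associated r q :=
        (hq.irreducible.associated_of_dvd hr.irreducible h).symm
      rcases hq.dvd_or_dvd hqd with h | h
      · exact (hql (hassoc gaussianInt_prime_one_add_I (hq.dvd_of_dvd_pow h)).symm).elim
      rw [dvd_neg] at h
      rcases hq.dvd_or_dvd h with h | h <;> rcases hq.dvd_or_dvd h with h | h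
      · exact ⟨c₁, m₁, h₁.of_associated (hassoc q₁ h)⟩
      · exact ⟨c₂, m₂, h₂.of_associated (hassoc q₁' h)⟩
      · exact ⟨c₃, m₃, h₃.of_associated (hassoc q₂ h)⟩
      · exact ⟨_, mul_mem (mul_mem m₁ m₂) m₃, h₄.of_associated (hassoc q₂' h)⟩
    obtain ⟨m, hm⟩ := H.exists_hasSquare hc fun X Y Z h ↦ by
      by_contra hZ
      have := norm_eq_trivial hne hm₁ hm₂ hφ₁ hφ₂ hπ₁ hπ₂ hs₁ hs₂
        zero_le_one zero_le_one zero_le_one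
        (Or.inr rfl) hZ (X := X) (Y := Y) (by simpa using h)
      simp [Zsqrtd.ext_iff] at this
    have hmem : c ∈ Subgroup.closure {c₁, c₂, c₃} := by
      obtain ⟨r, hmr, hr⟩ := (FiniteMultiplicity.of_prime_left gaussianInt_prime_one_add_I
        hm.ne_zero).exists_eq_pow_mul_and_not_dvd
      rw [hmr] at hm
      generalize multiplicity (⟨1, 1⟩ : ℤi) m = n at hm
      rcases Nat.even_or_odd' n with ⟨n, rfl | rfl⟩
      · exact H.mem_of_hasSquare hG (HasSquare.of_sq_mul (m := r) (r := ⟨1, 1⟩ ^ n)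
          (by rwa [← pow_mul, mul_comm n])) hr
      · refine H.mem_of_hasSquare hG (m := r * m')
          (HasSquare.of_sq_mul (r := ⟨1, 1⟩ ^ (n + 1)) ?_) ?_
        · convert hm.mul h₅ using 1
          · rw [mul_one]
          · ring
        · exact fun h ↦ (gaussianInt_prime_one_add_I.dvd_or_dvd h).elim hr hm'
    have hex : ∃ a b e : ℕ, c = c₁ ^ a * c₂ ^ b * c₃ ^ e := by
      clear hm hc
      induction hmem using Subgroup.closure_induction with
      | mem x hx =>
        simp only [Set.mem_insert_iff, Set.mem_singleton_iff] at hx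
        rcases hx with rfl | rfl | rfl
        · exact ⟨1, 0, 0, by simp⟩
        · exact ⟨0, 1, 0, by simp⟩
        · exact ⟨0, 0, 1, by simp⟩
      | one => exact ⟨0, 0, 0, by simp⟩
      | mul x y _ _ hx hy =>
        obtain ⟨a, b, e, rfl⟩ := hx
        obtain ⟨a', b', e', rfl⟩ := hy
        exact ⟨a + a', b + b', e + e', by simp only [pow_add]; ac_rfl⟩
      | inv x _ hx =>
        obtain ⟨a, b, e, rfl⟩ := hx
        refine ⟨a, b, e, ?_⟩
        rw [inv_eq_iff_mul_eq_one, ← pow_two]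
        exact (hcomb a b e).sq_eq_one
    obtain ⟨a, b, e, rfl⟩ := hex
    exact ⟨a % 2, b % 2, e % 2, by omega, by omega, by omega, by
      rw [← pow_eq_pow_mod a h₁.sq_eq_one, ← pow_eq_pow_mod b h₂.sq_eq_one,
        ← pow_eq_pow_mod e h₃.sq_eq_one]⟩
  refine exists_addEquiv_of_basis h₁.sq_eq_one h₂.sq_eq_one h₃.sq_eq_one (fun c hc ↦ ?_)
    (fun c hc ↦ ?_) (fun a b e ha hb he h ↦ ?_) P
  · obtain ⟨a, b, e, ha, hb, he, h⟩ := hspan _ hc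
    obtain ⟨rfl, rfl, rfl⟩ := htriv ha hb he (h ▸ hcomb a b e)
    simpa using h
  · obtain ⟨a, b, e, -, -, -, h⟩ := hspan c hc
    exact ⟨a, b, e, h⟩
  · exact htriv (c := 1) ha hb he (by simpa only [one_pow, h] using hcomb a b e)

end genus

section QuadraticAlgebra

variable {F K : Type*} [Field F] [Field K] [Algebra F K]

/-- The basis `1, s` of a quadratic extension of fields generated by a square root `s` of a
nonsquare. -/
lemma exists_basis_one_sqrt {δ : F} {s : K} (hs : s ^ 2 = algebraMap F K δ)
    (hδ : ∀ r : F, r ^ 2 ≠ δ)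
    (hspan : ∀ z : K, ∃ α β : F, z = algebraMap F K α + algebraMap F K β * s) :
    ∃ b : Module.Basis (Fin 2) F K, b 0 = 1 ∧ b 1 = s := by
  have hli : LinearIndependent F ![(1 : K), s] := by
    rw [LinearIndependent.pair_iff]
    intro α β h
    rw [Algebra.smul_def, Algebra.smul_def, mul_one] at h
    have hβ : β = 0 := by
      by_contra hβ
      refine hδ (α / β) ((algebraMap F K).injective ?_)
      have h' : algebraMap F K β ≠ 0 := by simpa using hβ
      rw [← hs, map_pow, map_div₀, div_pow, div_eq_iff (pow_ne_zero 2 h')]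
      linear_combination (algebraMap F K α - algebraMap F K β * s) * h
    subst hβ
    simpa using h
  have hsp : ⊤ ≤ Submodule.span F (Set.range ![(1 : K), s]) := by
    intro z _
    obtain ⟨α, β, rfl⟩ := hspan z
    rw [Matrix.range_cons, Matrix.range_cons, Matrix.range_empty, Set.union_empty]
    refine Submodule.mem_span_pair.2 ⟨α, β, ?_⟩
    simp [Algebra.smul_def]
  exact ⟨Module.Basis.mk hli hsp, by simp, by simp⟩

lemma leftMulMatrix_add_mul_sqrt {δ : F} {s : K} (hs : s ^ 2 = algebraMap F K δ)
    {b : Module.Basis (Fin 2) F K} (hb₀ : b 0 = 1) (hb₁ : b 1 = s) (α β : F) :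
    Algebra.leftMulMatrix b (algebraMap F K α + algebraMap F K β * s) = !![α, δ * β; β, α] := by
  have h₀ : (algebraMap F K α + algebraMap F K β * s) * b 0 = α • b 0 + β • b 1 := by
    rw [hb₀, hb₁, Algebra.smul_def, Algebra.smul_def]
    ring
  have h₁ : (algebraMap F K α + algebraMap F K β * s) * b 1 = (δ * β) • b 0 + α • b 1 := by
    rw [hb₀, hb₁, Algebra.smul_def, Algebra.smul_def, map_mul]
    linear_combination algebraMap F K β * hs
  ext i j
  rw [Algebra.leftMulMatrix_eq_repr_mul]
  fin_cases j
  · simp only [Fin.zero_eta, h₀]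
    fin_cases i <;> simp
  · simp only [Fin.mk_one, h₁]
    fin_cases i <;> simp

lemma trace_add_mul_sqrt {δ : F} {s : K} (hs : s ^ 2 = algebraMap F K δ)
    {b : Module.Basis (Fin 2) F K} (hb₀ : b 0 = 1) (hb₁ : b 1 = s) (α β : F) :
    Algebra.trace F K (algebraMap F K α + algebraMap F K β * s) = 2 * α := by
  rw [Algebra.trace_eq_matrix_trace b, leftMulMatrix_add_mul_sqrt hs hb₀ hb₁,
    Matrix.trace_fin_two_of, two_mul]

lemma norm_add_mul_sqrt {δ : F} {s : K} (hs : s ^ 2 = algebraMap F K δ)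
    {b : Module.Basis (Fin 2) F K} (hb₀ : b 0 = 1) (hb₁ : b 1 = s) (α β : F) :
    Algebra.norm F (algebraMap F K α + algebraMap F K β * s) = α ^ 2 - δ * β ^ 2 := by
  rw [Algebra.norm_eq_matrix_det b, leftMulMatrix_add_mul_sqrt hs hb₀ hb₁, Matrix.det_fin_two_of]
  ring

end QuadraticAlgebra

lemma isGaussianQuadratic_of_span {B K F : Type*} [CommRing B] [IsDedekindDomain B] [Field K]
    [Field F] [Algebra ℤi B] [Algebra B K] [Algebra ℤi K] [Algebra ℤi F] [Algebra F K]
    [IsScalarTower ℤi B K] [IsScalarTower ℤi F K] [IsFractionRing ℤi F] [IsFractionRing B K]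
    [Module.Finite ℤi B] [Module.IsTorsionFree ℤi B] {d : ℤi} {s : B}
    (hs : s ^ 2 = algebraMap ℤi B d) (hd : ∀ X Y : ℤi, X ^ 2 = d * Y ^ 2 → Y = 0)
    (hspan : ∀ z : K, ∃ α β : F, z = algebraMap F K α + algebraMap F K β * algebraMap B K s) :
    IsGaussianQuadratic B d s := by
  have hFK (a : ℤi) : algebraMap F K (algebraMap ℤi F a) = algebraMap B K (algebraMap ℤi B a) := by
    rw [← IsScalarTower.algebraMap_apply, ← IsScalarTower.algebraMap_apply]
  have hinjF := IsFractionRing.injective ℤi F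
  have hinjK := IsFractionRing.injective B K
  have hsK : algebraMap B K s ^ 2 = algebraMap F K (algebraMap ℤi F d) := by
    rw [hFK, ← map_pow, hs]
  have hδ (r : F) : r ^ 2 ≠ algebraMap ℤi F d := by
    intro h
    obtain ⟨a, b, hb, rfl⟩ := IsFractionRing.div_surjective (A := ℤi) r
    have hb0 : b ≠ 0 := nonZeroDivisors.ne_zero hb
    have hb' : algebraMap ℤi F b ≠ 0 := by
      rwa [Ne, map_eq_zero_iff _ hinjF]
    refine hb0 (hd a b (hinjF ?_))
    rw [div_pow, div_eq_iff (pow_ne_zero 2 hb')] at h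
    rw [map_pow, map_mul, map_pow, h]
  obtain ⟨b, hb₀, hb₁⟩ := exists_basis_one_sqrt hsK hδ hspan
  have : FiniteDimensional F K := b.finiteDimensional_of_finite
  have : IsIntegralClosure B ℤi K := IsIntegralClosure.of_isIntegrallyClosed B ℤi K
  have hnorm (x y : ℤi) :
      Algebra.intNorm ℤi B (algebraMap ℤi B x + algebraMap ℤi B y * s) = x ^ 2 - d * y ^ 2 := by
    apply hinjF
    rw [Algebra.algebraMap_intNorm (L := K), map_add, map_mul, ← hFK, ← hFK,
      norm_add_mul_sqrt hsK hb₀ hb₁]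
    simp
  refine ⟨hs, ?_, ?_, ?_, (Ideal.relNorm ℤi : Ideal B →*₀ Ideal ℤi), ?_⟩
  · rintro rfl
    exact hδ 0 (by simp)
  · intro x y h
    have h' := hnorm x y
    rw [h] at h'
    have h0 : x ^ 2 - d * y ^ 2 = 0 := by
      rw [← h']
      apply hinjF
      rw [Algebra.algebraMap_intNorm (L := K), map_zero (algebraMap B K), Algebra.norm_zero,
        map_zero]
    have hy := hd x y (sub_eq_zero.1 h0)
    subst hy
    exact ⟨by simpa using h0, rfl⟩
  · intro z
    refine ⟨d * Algebra.intTrace ℤi B z, Algebra.intTrace ℤi B (z * s), hinjK ?_⟩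
    obtain ⟨α, β, hz⟩ := hspan (algebraMap B K z)
    simp only [map_mul, map_add, ← hFK, Algebra.algebraMap_intTrace (L := K)]
    have hzs : algebraMap B K z * algebraMap B K s = algebraMap F K (β * algebraMap ℤi F d) +
        algebraMap F K α * algebraMap B K s := by
      rw [hz, map_mul]
      linear_combination algebraMap F K β * hsK
    rw [hzs, hz, trace_add_mul_sqrt hsK hb₀ hb₁, trace_add_mul_sqrt hsK hb₀ hb₁]
    simp only [map_mul, map_ofNat]
    ring
  · intro x y
    simp [hnorm, Ideal.relNorm_singleton]

lemma eq_zero_of_sq_eq_two_mul_primes_mul_sq {p₁ p₂ : ℕ} [Fact p₁.Prime] [Fact p₂.Prime]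
    (hne : p₁ ≠ p₂) (hm₁ : p₁ % 8 = 5) {X Y : ℤi}
    (h : X ^ 2 = ((2 * p₁ * p₂ : ℕ) : ℤi) * Y ^ 2) : Y = 0 := by
  by_contra hY
  obtain ⟨r, rfl⟩ : Y ∣ X := (IsIntegrallyClosed.pow_dvd_pow_iff two_ne_zero).1
    ⟨_, by rw [h, mul_comm]⟩
  have hr : r ^ 2 = ((2 * p₁ * p₂ : ℕ) : ℤi) :=
    mul_right_cancel₀ (pow_ne_zero 2 hY) (by rw [← h]; ring)
  obtain ⟨π, φ, hφ, hπ, hφ'⟩ := exists_split_prime p₁ (by omega)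
  have hprime : Prime π := prime_of_forall_map_eq_zero_iff hφ (by
    rintro rfl
    have : (p₁ : ℤi) ≠ 0 := by exact_mod_cast (Fact.out : p₁.Prime).ne_zero
    exact this (by rw [← hπ, zero_mul]))
  have hd : ((2 * p₁ * p₂ : ℕ) : ℤi) = π * (2 * star π * p₂) := by
    push_cast
    rw [← hπ]
    ring
  obtain ⟨t, rfl⟩ := hprime.dvd_of_dvd_pow (hr ▸ hd ▸ dvd_mul_right π _ : π ∣ r ^ 2)
  have hdvd : π ∣ 2 * star π * p₂ :=
    ⟨t ^ 2, mul_left_cancel₀ hprime.ne_zero (by rw [← hd, ← hr]; ring)⟩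
  rw [← hφ, map_mul, map_mul, map_natCast, map_ofNat] at hdvd
  have h2 : (2 : ZMod p₁) ≠ 0 := by
    intro h2
    have := (ZMod.natCast_eq_zero_iff 2 p₁).1 (by exact_mod_cast h2)
    have := Nat.le_of_dvd two_pos this
    omega
  have hp : (p₂ : ZMod p₁) ≠ 0 := by
    rw [Ne, ZMod.natCast_eq_zero_iff,
      Nat.prime_dvd_prime_iff_eq (Fact.out : p₁.Prime) (Fact.out : p₂.Prime)]
    exact hne
  exact mul_ne_zero (mul_ne_zero h2 hφ') hp hdvd

/-- Every element of `ℚ(x, i)` is of the form `(a + bi) + (c + ei)x` if `x²` is rational. -/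
lemma mem_adjoin_sqrt_I {x : ℂ} {n : ℕ} (hx : x ^ 2 = n) {z : ℂ}
    (hz : z ∈ ℚ⟮x, Complex.I⟯) :
    ∃ a b c e : ℚ, z = (a + b * Complex.I) + (c + e * Complex.I) * x := by
  have halg : ∀ y ∈ ({x, Complex.I} : Set ℂ), IsAlgebraic ℚ y := by
    have hI : IsIntegral ℚ Complex.I := .of_pow two_pos (by
      rw [Complex.I_sq]
      exact isIntegral_one.neg)
    have hx' : IsIntegral ℚ x := .of_pow two_pos (by
      rw [hx]
      exact_mod_cast isIntegral_algebraMap (R := ℚ) (A := ℂ) (x := (n : ℚ)))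
    rintro y (rfl | rfl)
    · exact hx'.isAlgebraic
    · exact hI.isAlgebraic
  rw [← IntermediateField.mem_toSubalgebra,
    IntermediateField.adjoin_toSubalgebra_of_isAlgebraic halg] at hz
  induction hz using Algebra.adjoin_induction with
  | mem y hy =>
    rcases hy with rfl | rfl
    · exact ⟨0, 0, 1, 0, by simp⟩
    · exact ⟨0, 1, 0, 0, by simp⟩
  | algebraMap r => exact ⟨r, 0, 0, 0, by simp⟩
  | add y z _ _ hy hz =>
    obtain ⟨a, b, c, e, rfl⟩ := hy
    obtain ⟨a', b', c', e', rfl⟩ := hz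
    exact ⟨a + a', b + b', c + c', e + e', by push_cast; ring⟩
  | mul y z _ _ hy hz =>
    obtain ⟨a, b, c, e, rfl⟩ := hy
    obtain ⟨a', b', c', e', rfl⟩ := hz
    refine ⟨a * a' - b * b' + n * (c * c' - e * e'), a * b' + b * a' + n * (c * e' + e * c'),
      a * c' - b * e' + c * a' - e * b', a * e' + b * c' + c * b' + e * a', ?_⟩
    push_cast
    linear_combination (c + e * Complex.I) * (c' + e' * Complex.I) * hx +
      (b * b' + (b * e' + e * b') * x + n * e * e') * Complex.I_sq

/-- A number field spanned over `ℚ` by `1, i, x, ix`, where `x² = d`, has a ring of integers which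
is a quadratic extension of `ℤ[i]`. -/
lemma exists_isGaussianQuadratic {K : Type*} [Field K] [NumberField K] {i x : K}
    (hi : i ^ 2 = -1) {n : ℕ} (hx : x ^ 2 = n)
    (hspan : ∀ z : K, ∃ a b c e : ℚ, z = (a + b * i) + (c + e * i) * x)
    (hn : ∀ X Y : ℤi, X ^ 2 = (n : ℤi) * Y ^ 2 → Y = 0) :
    ∃ (_ : Algebra ℤi (𝓞 K)) (s : 𝓞 K), IsGaussianQuadratic (𝓞 K) (n : ℤi) s := by
  have hiI : IsIntegral ℤ i := .of_pow two_pos (by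
    rw [hi]
    exact isIntegral_one.neg)
  have hxI : IsIntegral ℤ x := .of_pow two_pos (by
    rw [hx]
    exact_mod_cast isIntegral_algebraMap (R := ℤ) (A := K) (x := (n : ℤ)))
  let j : 𝓞 K := ⟨i, hiI⟩
  have hj : j * j = ((-1 : ℤ) : 𝓞 K) := by
    apply RingOfIntegers.ext
    change i * i = _
    rw [← sq, hi]
    simp
  let f : ℤi →+* 𝓞 K := Zsqrtd.lift ⟨j, hj⟩
  have hf : Function.Injective f := Zsqrtd.lift_injective _ (fun n h => by nlinarith)
  let _ : Algebra ℤi (𝓞 K) := f.toAlgebra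
  let _ : Algebra ℤi K := ((algebraMap (𝓞 K) K).comp f).toAlgebra
  have : IsScalarTower ℤi (𝓞 K) K := .of_algebraMap_eq fun _ => rfl
  have : FaithfulSMul ℤi (𝓞 K) := (faithfulSMul_iff_algebraMap_injective _ _).2 hf
  have : FaithfulSMul ℤi K := (faithfulSMul_iff_algebraMap_injective _ _).2
    ((FaithfulSMul.algebraMap_injective (𝓞 K) K).comp hf)
  have : Module.Finite ℤi (𝓞 K) := .of_restrictScalars_finite ℤ ℤi (𝓞 K)
  let _ := FractionRing.liftAlgebra ℤi K
  have := FractionRing.isScalarTower_liftAlgebra ℤi K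
  let I' : FractionRing ℤi := algebraMap ℤi _ ⟨0, 1⟩
  have hI : algebraMap (FractionRing ℤi) K I' = i := by
    rw [← IsScalarTower.algebraMap_apply]
    change algebraMap (𝓞 K) K (f ⟨0, 1⟩) = i
    simp only [f, Zsqrtd.lift_apply_apply, Int.cast_zero, Int.cast_one, zero_add]
    exact congrArg (algebraMap (𝓞 K) K) (one_mul j)
  have hxs : algebraMap (𝓞 K) K ⟨x, hxI⟩ = x := rfl
  refine ⟨inferInstance, ⟨x, hxI⟩, isGaussianQuadratic_of_span (K := K) (F := FractionRing ℤi) ?_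
    hn fun z => ?_⟩
  · apply RingOfIntegers.ext
    change x ^ 2 = _
    simp [hx]
  · obtain ⟨a, b, c, e, rfl⟩ := hspan z
    exact ⟨a + b * I', c + e * I', by simp [hI, hxs]⟩

/-- For distinct primes `p₁ ≡ p₂ ≡ 5 (mod 8)`, the 2-Sylow subgroup of the
ideal class group of `𝕜 = ℚ(√(2p₁p₂), i)` is isomorphic to `ℤ/2ℤ × ℤ/2ℤ × ℤ/2ℤ`. -/
theorem stmt_1 (p₁ p₂ : ℕ) (hp₁ : p₁.Prime) (hp₂ : p₂.Prime) (hne : p₁ ≠ p₂)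
    (hm₁ : p₁ % 8 = 5) (hm₂ : p₂ % 8 = 5)
    (x : ℂ) (hx : x ^ 2 = ((2 * p₁ * p₂ : ℕ) : ℂ))
    (𝕜 : IntermediateField ℚ ℂ) (h𝕜 : 𝕜 = ℚ⟮x, Complex.I⟯) [NumberField 𝕜] :
    ∀ P : Sylow 2 (ClassGroup (RingOfIntegers 𝕜)),
      Nonempty (Additive P ≃+ (ZMod 2 × ZMod 2 × ZMod 2)) := by
  intro P
  have := Fact.mk hp₁
  have := Fact.mk hp₂
  have hxm : x ∈ 𝕜 := h𝕜 ▸ subset_adjoin ℚ _ (by simp)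
  have him : Complex.I ∈ 𝕜 := h𝕜 ▸ subset_adjoin ℚ _ (by simp)
  obtain ⟨_, s, H⟩ := exists_isGaussianQuadratic (K := 𝕜) (i := ⟨Complex.I, him⟩) (x := ⟨x, hxm⟩)
    (n := 2 * p₁ * p₂) (Subtype.ext (by simp)) (Subtype.ext hx)
    (fun z => by
      obtain ⟨a, b, c, e, h⟩ := mem_adjoin_sqrt_I hx (h𝕜.le z.2)
      exact ⟨a, b, c, e, Subtype.ext (by simpa using h)⟩)
    (fun X Y => eq_zero_of_sq_eq_two_mul_primes_mul_sq hne hm₁)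
  exact H.exists_addEquiv_sylow hne hm₁ hm₂ P
end

section
/- The discriminant of the number field 𝕜 = ℚ(√(2p₁p₂), i) equals 2⁸·p₁²·p₂². -/
open NumberField IntermediateField

theorem Rat.exists_int_eq_of_isIntegral {q : ℚ} (h : IsIntegral ℤ (q : ℂ)) :
    ∃ n : ℤ, (n : ℚ) = q := by
  have h' : IsIntegral ℤ (algebraMap ℚ ℂ q) := by simpa using h
  rw [isIntegral_algebraMap_iff (algebraMap ℚ ℂ).injective] at h'
  simpa using IsIntegrallyClosed.isIntegral_iff.mp h'

theorem Rat.exists_int_eq_of_sq_eq_intCast {q : ℚ} {k : ℤ} (h : q ^ 2 = k) :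
    ∃ n : ℤ, (n : ℚ) = q := by
  have h' : IsIntegral ℤ q := by
    refine IsIntegral.of_pow two_pos ?_
    rw [h]
    exact isIntegral_algebraMap (R := ℤ) (x := k)
  simpa using IsIntegrallyClosed.isIntegral_iff.mp h'

theorem Rat.exists_int_eq_of_squarefree_mul_sq {N : ℤ} (hN : Squarefree N) {q : ℚ} {k : ℤ}
    (h : N * q ^ 2 = k) : ∃ n : ℤ, (n : ℚ) = q := by
  have hN0 : (N : ℚ) ≠ 0 := by exact_mod_cast hN.ne_zero
  obtain ⟨t, ht⟩ := Rat.exists_int_eq_of_sq_eq_intCast (q := N * q) (k := N * k) (by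
    push_cast
    linear_combination (N : ℚ) * h)
  have htk : t ^ 2 = N * k := by
    have : (t : ℚ) ^ 2 = N * k := by
      rw [ht]
      linear_combination (N : ℚ) * h
    exact_mod_cast this
  obtain ⟨s, rfl⟩ := (hN.dvd_pow_iff_dvd two_ne_zero).mp (Dvd.intro k htk.symm)
  refine ⟨s, mul_left_cancel₀ hN0 ?_⟩
  rw [← ht]
  push_cast
  rfl

theorem Int.even_of_four_dvd_sq_add_sq {a b : ℤ} (h : 4 ∣ a ^ 2 + b ^ 2) : 2 ∣ a ∧ 2 ∣ b := by
  have ha : a % 4 = 0 ∨ a % 4 = 1 ∨ a % 4 = 2 ∨ a % 4 = 3 := by omega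
  have hb : b % 4 = 0 ∨ b % 4 = 1 ∨ b % 4 = 2 ∨ b % 4 = 3 := by omega
  have h' := Int.emod_eq_zero_of_dvd h
  rcases ha with ha | ha | ha | ha <;> rcases hb with hb | hb | hb | hb <;>
    simp [pow_two, Int.add_emod, Int.mul_emod, ha, hb] at h' <;> omega

theorem Complex.isIntegral_I : IsIntegral ℤ Complex.I := by
  refine IsIntegral.of_pow two_pos ?_
  rw [Complex.I_sq]
  exact isIntegral_one.neg

theorem Complex.exists_int_eq_of_isIntegral_add_mul_I {p q : ℚ}
    (h : IsIntegral ℤ (p + q * Complex.I : ℂ)) :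
    (∃ n : ℤ, (n : ℚ) = p) ∧ ∃ n : ℤ, (n : ℚ) = q := by
  have hc : IsIntegral ℤ (p - q * Complex.I : ℂ) := by
    have := map_isIntegral_int (starRingEnd ℂ) h
    simpa [sub_eq_add_neg] using this
  obtain ⟨P, hP⟩ := Rat.exists_int_eq_of_isIntegral (q := 2 * p) (by
    refine (congrArg (IsIntegral ℤ) ?_).mpr (h.add hc)
    push_cast
    ring)
  obtain ⟨Q, hQ⟩ := Rat.exists_int_eq_of_isIntegral (q := 2 * q) (by
    refine (congrArg (IsIntegral ℤ) ?_).mpr ((hc.sub h).mul Complex.isIntegral_I)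
    push_cast
    linear_combination (2 * q : ℂ) * Complex.I_sq)
  obtain ⟨k, hk⟩ := Rat.exists_int_eq_of_isIntegral (q := p ^ 2 + q ^ 2) (by
    refine (congrArg (IsIntegral ℤ) ?_).mpr (h.mul hc)
    push_cast
    linear_combination (q ^ 2 : ℂ) * Complex.I_sq)
  have h4 : P ^ 2 + Q ^ 2 = 4 * k := by
    have : (P : ℚ) ^ 2 + Q ^ 2 = 4 * k := by
      rw [hP, hQ, hk]
      ring
    exact_mod_cast this
  obtain ⟨⟨r, rfl⟩, s, rfl⟩ := Int.even_of_four_dvd_sq_add_sq (Dvd.intro k h4.symm)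
  push_cast at hP hQ
  exact ⟨⟨r, by linarith⟩, s, by linarith⟩

theorem Int.even_of_four_dvd_gaussian_sq_sub {A B C D m : ℤ} (hm : Odd m)
    (h₁ : 4 ∣ A ^ 2 - B ^ 2 + 2 * m * C * D) (h₂ : 4 ∣ 2 * A * B - m * (C ^ 2 - D ^ 2)) :
    2 ∣ A ∧ 2 ∣ B ∧ 2 ∣ C ∧ 2 ∣ D := by
  have key : ∀ A B C D m : ZMod 4, A ^ 2 - B ^ 2 + 2 * m * C * D = 0 →
      2 * A * B - m * (C ^ 2 - D ^ 2) = 0 → 2 * m = 2 →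
      2 * A = 0 ∧ 2 * B = 0 ∧ 2 * C = 0 ∧ 2 * D = 0 := by decide
  have hdvd : ∀ n : ℤ, (2 * n : ZMod 4) = 0 → 2 ∣ n := fun n hn ↦ by
    have : ((2 * n : ℤ) : ZMod 4) = 0 := by exact_mod_cast hn
    have := (ZMod.intCast_zmod_eq_zero_iff_dvd _ 4).mp this
    omega
  obtain ⟨hA, hB, hC, hD⟩ := key A B C D m
    (by exact_mod_cast (ZMod.intCast_zmod_eq_zero_iff_dvd _ 4).mpr h₁)
    (by exact_mod_cast (ZMod.intCast_zmod_eq_zero_iff_dvd _ 4).mpr h₂)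
    (by
      obtain ⟨k, rfl⟩ := hm
      push_cast
      have : (4 : ZMod 4) = 0 := by decide
      linear_combination (k : ZMod 4) * this)
  exact ⟨hdvd _ hA, hdvd _ hB, hdvd _ hC, hdvd _ hD⟩

/-- The complex number `a + b i + c y + d i y`. -/
noncomputable def gaussPair (y : ℂ) (a b c d : ℚ) : ℂ :=
  a + b * Complex.I + c * y + d * (Complex.I * y)

section
variable {m : ℕ} {y : ℂ}

theorem gaussPair_mul (hy : y ^ 2 = m * Complex.I) (a b c d a' b' c' d' : ℚ) :
    gaussPair y a b c d * gaussPair y a' b' c' d' =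
      gaussPair y (a * a' - b * b' - m * (c * d' + d * c')) (a * b' + b * a' + m * (c * c' - d * d'))
        (a * c' - b * d' + c * a' - d * b') (a * d' + b * c' + c * b' + d * a') := by
  simp only [gaussPair]
  push_cast
  linear_combination (c + d * Complex.I) * (c' + d' * Complex.I) * hy +
    (b * b' + b * d' * y + d * b' * y + m * (c * d' + d * c') + d * d' * m * Complex.I) *
      Complex.I_sq

theorem exists_gaussPair_aeval (hy : y ^ 2 = m * Complex.I) (a b c d : ℚ) (P : Polynomial ℤ) :
    ∃ a' b' c' d' : ℚ, P.aeval (gaussPair y a b c d) = gaussPair y a' b' c' d' ∧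
      P.aeval (gaussPair y a b (-c) (-d)) = gaussPair y a' b' (-c') (-d') := by
  induction P using Polynomial.induction_on with
  | C n => exact ⟨n, 0, 0, 0, by simp [gaussPair], by simp [gaussPair]⟩
  | add P Q hP hQ =>
    obtain ⟨a₁, b₁, c₁, d₁, h₁, h₁'⟩ := hP
    obtain ⟨a₂, b₂, c₂, d₂, h₂, h₂'⟩ := hQ
    refine ⟨a₁ + a₂, b₁ + b₂, c₁ + c₂, d₁ + d₂, ?_, ?_⟩
    · rw [map_add, h₁, h₂]
      simp only [gaussPair]
      push_cast
      ring
    · rw [map_add, h₁', h₂']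
      simp only [gaussPair]
      push_cast
      ring
  | monomial k n h =>
    obtain ⟨a₁, b₁, c₁, d₁, h₁, h₁'⟩ := h
    rw [pow_succ, ← mul_assoc]
    refine ⟨_, _, _, _, by rw [map_mul, h₁, Polynomial.aeval_X, gaussPair_mul hy], ?_⟩
    rw [map_mul, h₁', Polynomial.aeval_X, gaussPair_mul hy]
    congr 1 <;> ring

theorem isIntegral_gaussPair_conj (hy : y ^ 2 = m * Complex.I)
    (hind : ∀ a b c d : ℚ, gaussPair y a b c d = 0 → a = 0 ∧ b = 0 ∧ c = 0 ∧ d = 0)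
    {a b c d : ℚ} (h : IsIntegral ℤ (gaussPair y a b c d)) :
    IsIntegral ℤ (gaussPair y a b (-c) (-d)) := by
  obtain ⟨P, hP, hP0⟩ := h
  obtain ⟨a', b', c', d', h₁, h₂⟩ := exists_gaussPair_aeval hy a b c d P
  refine ⟨P, hP, ?_⟩
  rw [← Polynomial.aeval_def] at hP0 ⊢
  obtain ⟨rfl, rfl, rfl, rfl⟩ := hind a' b' c' d' (h₁.symm.trans hP0)
  rw [h₂]
  simp [gaussPair]

theorem exists_int_of_isIntegral_gaussPair (hm : Odd m) (hsq : Squarefree m)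
    (hy : y ^ 2 = m * Complex.I)
    (hind : ∀ a b c d : ℚ, gaussPair y a b c d = 0 → a = 0 ∧ b = 0 ∧ c = 0 ∧ d = 0)
    {a b c d : ℚ} (h : IsIntegral ℤ (gaussPair y a b c d)) :
    ∃ a' b' c' d' : ℤ, (a' : ℚ) = a ∧ (b' : ℚ) = b ∧ (c' : ℚ) = c ∧ (d' : ℚ) = d := by
  have hc := isIntegral_gaussPair_conj hy hind h
  obtain ⟨⟨A, hA⟩, B, hB⟩ := Complex.exists_int_eq_of_isIntegral_add_mul_I
    (p := 2 * a) (q := 2 * b) (by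
      refine (congrArg (IsIntegral ℤ) ?_).mpr (h.add hc)
      simp only [gaussPair]
      push_cast
      ring)
  obtain ⟨⟨R, hR⟩, S, hS⟩ := Complex.exists_int_eq_of_isIntegral_add_mul_I
    (p := a ^ 2 - b ^ 2 + 2 * m * (c * d)) (q := 2 * a * b - m * (c ^ 2 - d ^ 2)) (by
      refine (congrArg (IsIntegral ℤ) ?_).mpr (h.mul hc)
      rw [gaussPair_mul hy]
      simp only [gaussPair]
      push_cast
      ring)
  have h2m : Squarefree ((2 * m : ℕ) : ℤ) := by
    rw [Int.squarefree_natCast, Nat.squarefree_mul (Nat.coprime_two_left.mpr hm)]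
    exact ⟨Nat.prime_two.squarefree, hsq⟩
  obtain ⟨T, hT⟩ := Rat.exists_int_eq_of_sq_eq_intCast
    (q := m * ((2 * c) ^ 2 + (2 * d) ^ 2))
    (k := (2 * A * B - 4 * S) ^ 2 + (4 * R - A ^ 2 + B ^ 2) ^ 2) (by
      push_cast
      rw [hA, hB, hR, hS]
      ring)
  obtain ⟨C, hC⟩ := Rat.exists_int_eq_of_squarefree_mul_sq h2m
    (q := 2 * c) (k := T + (2 * A * B - 4 * S)) (by
      push_cast
      rw [hT, hA, hB, hS]
      ring)
  obtain ⟨D, hD⟩ := Rat.exists_int_eq_of_squarefree_mul_sq h2m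
    (q := 2 * d) (k := T - (2 * A * B - 4 * S)) (by
      push_cast
      rw [hT, hA, hB, hS]
      ring)
  have h₁ : A ^ 2 - B ^ 2 + 2 * (m : ℤ) * C * D = 4 * R := by
    have : (A : ℚ) ^ 2 - B ^ 2 + 2 * m * C * D = 4 * R := by
      rw [hA, hB, hC, hD, hR]
      ring
    exact_mod_cast this
  have h₂ : 2 * A * B - (m : ℤ) * (C ^ 2 - D ^ 2) = 4 * S := by
    have : 2 * (A : ℚ) * B - m * (C ^ 2 - D ^ 2) = 4 * S := by
      rw [hA, hB, hC, hD, hS]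
      ring
    exact_mod_cast this
  obtain ⟨⟨a', rfl⟩, ⟨b', rfl⟩, ⟨c', rfl⟩, d', rfl⟩ :=
    Int.even_of_four_dvd_gaussian_sq_sub ((Int.odd_coe_nat m).mpr hm)
      (Dvd.intro R h₁.symm) (Dvd.intro S h₂.symm)
  push_cast at hA hB hC hD
  exact ⟨a', b', c', d', by linarith, by linarith, by linarith, by linarith⟩

theorem gaussPair_eq_zero {r : ℝ} (hr : Irrational r) {a b c d : ℚ}
    (h : gaussPair (r * (1 + Complex.I) / 2) a b c d = 0) : a = 0 ∧ b = 0 ∧ c = 0 ∧ d = 0 := by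
  have key : ∀ p q : ℚ, (p : ℝ) + q * r = 0 → p = 0 ∧ q = 0 := fun p q hpq ↦ by
    have hq : q = 0 := by
      by_contra hq
      refine hr ⟨-p / q, ?_⟩
      have : (q : ℝ) ≠ 0 := by exact_mod_cast hq
      push_cast
      field_simp
      linarith
    subst hq
    exact ⟨by simpa using hpq, rfl⟩
  have hre := congrArg Complex.re h
  have him := congrArg Complex.im h
  simp [gaussPair] at hre him
  obtain ⟨h₁, h₂⟩ := key a ((c - d) / 2) (by push_cast; linarith)
  obtain ⟨h₃, h₄⟩ := key b ((c + d) / 2) (by push_cast; linarith)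
  exact ⟨h₁, h₃, by linarith, by linarith⟩

theorem isIntegral_of_sq_eq_mul_I (hy : y ^ 2 = m * Complex.I) : IsIntegral ℤ y := by
  refine IsIntegral.of_pow two_pos ?_
  rw [hy]
  exact IsIntegral.mul (isIntegral_algebraMap (R := ℤ) (x := m)) Complex.isIntegral_I

theorem exists_gaussPair_of_mem_adjoin (hy : y ^ 2 = m * Complex.I) {z : ℂ}
    (hz : z ∈ ℚ⟮y - Complex.I * y, Complex.I⟯) : ∃ a b c d : ℚ, z = gaussPair y a b c d := by
  have hyI : IsIntegral ℤ (y - Complex.I * y) :=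
    have hy' := isIntegral_of_sq_eq_mul_I hy
    hy'.sub (Complex.isIntegral_I.mul hy')
  rw [← IntermediateField.mem_toSubalgebra,
    IntermediateField.adjoin_toSubalgebra_of_isAlgebraic (by
      rintro w (rfl | rfl)
      · exact hyI.tower_top.isAlgebraic
      · exact Complex.isIntegral_I.tower_top.isAlgebraic)] at hz
  induction hz using Algebra.adjoin_induction with
  | mem w hw =>
    rcases hw with rfl | rfl
    · exact ⟨0, 0, 1, -1, by simp [gaussPair, sub_eq_add_neg]⟩
    · exact ⟨0, 1, 0, 0, by simp [gaussPair]⟩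
  | algebraMap q => exact ⟨q, 0, 0, 0, by simp [gaussPair]⟩
  | add u v _ _ hu hv =>
    obtain ⟨a₁, b₁, c₁, d₁, rfl⟩ := hu
    obtain ⟨a₂, b₂, c₂, d₂, rfl⟩ := hv
    refine ⟨a₁ + a₂, b₁ + b₂, c₁ + c₂, d₁ + d₂, ?_⟩
    simp only [gaussPair]
    push_cast
    ring
  | mul u v _ _ hu hv =>
    obtain ⟨a₁, b₁, c₁, d₁, rfl⟩ := hu
    obtain ⟨a₂, b₂, c₂, d₂, rfl⟩ := hv
    exact ⟨_, _, _, _, gaussPair_mul hy ..⟩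
end

/-- The discriminant of a `ℤ`-basis `1, i, y, i * y` with `i ^ 2 = -1` and `y ^ 2 = m * i`. -/
theorem Algebra.discr_eq_of_basis_gaussian_sqrt {S : Type*} [CommRing S]
    (b : Module.Basis (Fin 4) ℤ S) {m : ℤ} (h0 : b 0 = 1) (h1 : b 1 ^ 2 = -1) (h2 : b 2 ^ 2 = m * b 1) (h3 : b 3 = b 1 * b 2) :
    Algebra.discr ℤ b = 256 * m ^ 2 := by
  have t0 : Algebra.trace ℤ S 1 = 4 := by
    have : Nontrivial S := b.repr.toEquiv.nontrivial
    have : Module.Free ℤ S := .of_basis b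
    have := Algebra.trace_algebraMap_of_basis b (1 : ℤ)
    simpa using this
  have e11 : b 1 * b 1 = -b 0 := by rw [h0]; linear_combination h1
  have e12 : b 1 * b 2 = b 3 := h3.symm
  have e13 : b 1 * b 3 = -b 2 := by rw [h3]; linear_combination b 2 * h1
  have e22 : b 2 * b 2 = m • b 1 := by rw [zsmul_eq_mul]; linear_combination h2
  have e23 : b 2 * b 3 = -m • b 0 := by
    rw [zsmul_eq_mul, h0, h3]
    push_cast
    linear_combination b 1 * h2 + m * h1
  have e33 : b 3 * b 3 = -m • b 1 := by
    rw [zsmul_eq_mul, h3]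
    push_cast
    linear_combination b 1 ^ 2 * h2 + m * b 1 * h1
  have t1 : Algebra.trace ℤ S (b 1) = 0 := by
    rw [Algebra.trace_eq_matrix_trace b, Matrix.trace]
    simp [-zsmul_eq_mul, Fin.sum_univ_four, Algebra.leftMulMatrix_eq_repr_mul, e11, e12, e13,
      h0 ▸ mul_one (b 1)]
  have t2 : Algebra.trace ℤ S (b 2) = 0 := by
    rw [Algebra.trace_eq_matrix_trace b, Matrix.trace]
    simp [-zsmul_eq_mul, Fin.sum_univ_four, Algebra.leftMulMatrix_eq_repr_mul, mul_comm (b 2) (b 1),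
      e22, e23, e12, h0 ▸ mul_one (b 2)]
  have t3 : Algebra.trace ℤ S (b 3) = 0 := by
    rw [Algebra.trace_eq_matrix_trace b, Matrix.trace]
    simp [-zsmul_eq_mul, Fin.sum_univ_four, Algebra.leftMulMatrix_eq_repr_mul, mul_comm (b 3) (b 1),
      mul_comm (b 3) (b 2), e13, e23, e33, h0 ▸ mul_one (b 3)]
  have tm : Algebra.trace ℤ S m = m * 4 := by
    rw [← mul_one (m : S), ← zsmul_eq_mul, map_zsmul, t0, smul_eq_mul]
  have hM : Algebra.traceMatrix ℤ b =
      !![4, 0, 0, 0; 0, -4, 0, 0; 0, 0, 0, -m * 4; 0, 0, -m * 4, 0] := by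
    ext i j
    rw [Algebra.traceMatrix_apply, Algebra.traceForm_apply]
    fin_cases i <;> fin_cases j <;>
      simp [-zsmul_eq_mul, mul_comm (b 2) (b 1), mul_comm (b 3) (b 1), mul_comm (b 3) (b 2),
        e11, e12, e13, e22, e23, e33, h0, t0, t1, t2, t3, tm]
  rw [Algebra.discr_def, hM]
  simp [Matrix.det_succ_row_zero, Fin.sum_univ_succ, Fin.succAbove]
  ring

/-- The discriminant of `ℚ(√(2m), i)` for odd squarefree `m`. -/
theorem discr_adjoin_sqrt_two_mul_I {m : ℕ} (hm : Odd m) (hsq : Squarefree m) {x : ℂ}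
    (hx : x ^ 2 = ((2 * m : ℕ) : ℂ)) [NumberField ℚ⟮x, Complex.I⟯] :
    NumberField.discr ℚ⟮x, Complex.I⟯ = 256 * (m : ℤ) ^ 2 := by
  obtain ⟨r, hr, rfl⟩ : ∃ r : ℝ, Irrational r ∧ (r : ℂ) = x := by
    have hirr : Irrational √(2 * m : ℕ) := by
      rw [irrational_sqrt_natCast_iff]
      rintro ⟨k, hk⟩
      obtain ⟨l, rfl⟩ : 2 ∣ k := by
        rcases Nat.prime_two.dvd_mul.mp (Dvd.intro m hk) with h | h <;> exact h
      obtain ⟨n, rfl⟩ := hm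
      have : 2 * (l * l) = 2 * n + 1 := by linarith
      omega
    have hs : ((√(2 * m : ℕ) : ℝ) : ℂ) ^ 2 = x ^ 2 := by
      rw [hx, ← Complex.ofReal_pow, Real.sq_sqrt (Nat.cast_nonneg _), Complex.ofReal_natCast]
    rcases sq_eq_sq_iff_eq_or_eq_neg.mp hs with h | h
    · exact ⟨_, hirr, h⟩
    · exact ⟨_, hirr.neg, by rw [Complex.ofReal_neg, h, neg_neg]⟩
  obtain ⟨y, hydef⟩ : ∃ y : ℂ, y = r * (1 + Complex.I) / 2 := ⟨_, rfl⟩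
  have hy : y ^ 2 = m * Complex.I := by
    push_cast at hx
    rw [hydef]
    linear_combination (1 + Complex.I) ^ 2 / 4 * hx + m / 2 * Complex.I_sq
  have hxy : (r : ℂ) = y - Complex.I * y := by
    rw [hydef]
    linear_combination (r : ℂ) / 2 * Complex.I_sq
  have hind : ∀ a b c d : ℚ, gaussPair y a b c d = 0 → a = 0 ∧ b = 0 ∧ c = 0 ∧ d = 0 :=
    fun a b c d h ↦ gaussPair_eq_zero hr (hydef ▸ h)
  have hrK : (r : ℂ) ∈ ℚ⟮(r : ℂ), Complex.I⟯ := subset_adjoin _ _ (by simp)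
  have hIK : Complex.I ∈ ℚ⟮(r : ℂ), Complex.I⟯ := subset_adjoin _ _ (by simp)
  have hyK : y ∈ ℚ⟮(r : ℂ), Complex.I⟯ := by
    rw [hydef]
    exact div_mem (mul_mem hrK (add_mem (one_mem _) hIK)) (ofNat_mem _ 2)
  let f : 𝓞 ℚ⟮(r : ℂ), Complex.I⟯ →+* ℂ :=
    (algebraMap ℚ⟮(r : ℂ), Complex.I⟯ ℂ).comp (algebraMap (𝓞 _) _)
  have hf : Function.Injective f :=
    (algebraMap ℚ⟮(r : ℂ), Complex.I⟯ ℂ).injective.comp RingOfIntegers.coe_injective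
  have lift : ∀ z ∈ ℚ⟮(r : ℂ), Complex.I⟯, IsIntegral ℤ z → ∃ w, f w = z := fun z hz hzi ↦
    ⟨⟨⟨z, hz⟩, (isIntegral_algebraMap_iff (algebraMap ℚ⟮(r : ℂ), Complex.I⟯ ℂ).injective).mp hzi⟩,
      rfl⟩
  obtain ⟨ι, hι⟩ := lift _ hIK Complex.isIntegral_I
  obtain ⟨η, hη⟩ := lift _ hyK (isIntegral_of_sq_eq_mul_I hy)
  have hsum : ∀ g : Fin 4 → ℤ, f (∑ i, g i • ![1, ι, η, ι * η] i) =
      gaussPair y (g 0) (g 1) (g 2) (g 3) := fun g ↦ by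
    simp [Fin.sum_univ_four, gaussPair, hι, hη]
  let b : Module.Basis (Fin 4) ℤ (𝓞 ℚ⟮(r : ℂ), Complex.I⟯) :=
    Module.Basis.mk (v := ![1, ι, η, ι * η])
      (by
        rw [Fintype.linearIndependent_iff]
        intro g hg
        have := hind _ _ _ _ ((hsum g).symm.trans (by rw [hg, map_zero]))
        simp only [Int.cast_eq_zero] at this
        intro i
        fin_cases i <;> simp [this])
      (by
        intro z _
        have hz : IsIntegral ℤ (f z) := map_isIntegral_int f (Algebra.IsIntegral.isIntegral z)
        have hzK : f z ∈ ℚ⟮y - Complex.I * y, Complex.I⟯ := by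
          rw [← hxy]
          exact (algebraMap (𝓞 ℚ⟮(r : ℂ), Complex.I⟯) ℚ⟮(r : ℂ), Complex.I⟯ z).2
        obtain ⟨a, b, c, d, habcd⟩ := exists_gaussPair_of_mem_adjoin hy hzK
        obtain ⟨a, b, c, d, rfl, rfl, rfl, rfl⟩ :=
          exists_int_of_isIntegral_gaussPair hm hsq hy hind (habcd ▸ hz)
        rw [Submodule.mem_span_range_iff_exists_fun]
        exact ⟨![a, b, c, d], hf ((hsum _).trans habcd.symm)⟩)
  rw [← NumberField.discr_eq_discr _ b]
  refine Algebra.discr_eq_of_basis_gaussian_sqrt b ?_ ?_ ?_ ?_ <;>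
    simp only [b, Module.Basis.mk_apply]
  · rfl
  · exact hf (by simp [hι])
  · exact hf (by simp [hι, hη, hy])
  · rfl

/-- For distinct primes `p₁ ≡ p₂ ≡ 5 (mod 8)`, the discriminant of the number
field `𝕜 = ℚ(√(2p₁p₂), i)` equals `2⁸·p₁²·p₂²`. -/
theorem stmt_2 (p₁ p₂ : ℕ) (hp₁ : p₁.Prime) (hp₂ : p₂.Prime) (hne : p₁ ≠ p₂)
    (hm₁ : p₁ % 8 = 5) (hm₂ : p₂ % 8 = 5)
    (x : ℂ) (hx : x ^ 2 = ((2 * p₁ * p₂ : ℕ) : ℂ))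
    (𝕜 : IntermediateField ℚ ℂ) (h𝕜 : 𝕜 = ℚ⟮x, Complex.I⟯)
    [NumberField 𝕜] :
    NumberField.discr 𝕜 = 2 ^ 8 * (p₁ : ℤ) ^ 2 * (p₂ : ℤ) ^ 2 := by
  subst h𝕜
  have hodd : Odd (p₁ * p₂) :=
    (Nat.odd_iff.mpr (by omega)).mul (Nat.odd_iff.mpr (by omega))
  have hsq : Squarefree (p₁ * p₂) :=
    (Nat.squarefree_mul ((Nat.coprime_primes hp₁ hp₂).mpr hne)).mpr
      ⟨hp₁.prime.squarefree, hp₂.prime.squarefree⟩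
  rw [discr_adjoin_sqrt_two_mul_I hodd hsq (by rw [hx, mul_assoc])]
  push_cast
  ring
end
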